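/- arXiv:1409.6229 — 5 statements merged into one kernel-verified Lean document; each statement's English description precedes it below -/
import Mathlib

section
/- For every λ ∈ ℝ \ {0} there exists a constant C > 0 such that for all μ ∈ ℂ with Re(μ) ≥ 0 and μ ≠ 0, and all real numbers 0 < t ≤ x, one has |G(x,t,μ)| ≤ C · (x/(1+|μ|x))^{1/2} · (t/(1+|μ|t))^{1/2} · e^{Re(μ)(x−t)}. -/
open Filter

/-- Modified Bessel function of the first kind, via its series, with
principal-branch complex powers. -/
noncomputable def besselI (ν z : ℂ) : ℂ :=
  ∑' k : ℕ, (z / 2) ^ (ν + 2 * (k : ℂ)) /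
    (Complex.Gamma ((k : ℂ) + ν + 1) * (Nat.factorial k : ℂ))

/-- Modified Bessel function of the second kind (for `ν ∉ ℤ`). -/
noncomputable def besselK (ν z : ℂ) : ℂ :=
  (Real.pi / 2 : ℂ) * (besselI (-ν) z - besselI ν z) / Complex.sin (ν * Real.pi)

/-- The Green kernel `G(x,t,μ) = √(xt)·(I_{iλ}(μx)K_{iλ}(μt) − I_{iλ}(μt)K_{iλ}(μx))`. -/
noncomputable def greenKernel (lam : ℝ) (x t : ℝ) (μ : ℂ) : ℂ :=
  (Real.sqrt (x * t) : ℂ) *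
    (besselI (Complex.I * lam) (μ * x) * besselK (Complex.I * lam) (μ * t)
      - besselI (Complex.I * lam) (μ * t) * besselK (Complex.I * lam) (μ * x))

/-- The coefficients `1 / (Γ(k + ν + 1) k!)` of the entire part of `besselI ν`. -/
noncomputable def besselCoeff (ν : ℂ) (k : ℕ) : ℂ :=
  (Complex.Gamma (k + ν + 1))⁻¹ * (Nat.factorial k : ℂ)⁻¹

/-- The entire function `y ↦ ∑ yᵏ / (Γ(k + ν + 1) k!)`, so that
`besselI ν z = (z / 2) ^ ν * besselEntire ν (z ^ 2 / 4)`. -/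
noncomputable def besselEntire (ν y : ℂ) : ℂ := ∑' k : ℕ, besselCoeff ν k * y ^ k

theorem succ_mul_besselCoeff_succ (ν : ℂ) (k : ℕ) :
    ((k : ℂ) + 1) * besselCoeff ν (k + 1) = besselCoeff (ν + 1) k := by
  have hk : (k : ℂ) + 1 ≠ 0 := Nat.cast_add_one_ne_zero k
  have hf : (Nat.factorial k : ℂ) ≠ 0 := Nat.cast_ne_zero.2 k.factorial_ne_zero
  simp only [besselCoeff, Nat.factorial_succ]
  push_cast
  rw [show (k : ℂ) + 1 + ν + 1 = k + (ν + 1) + 1 by ring, mul_inv]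
  field_simp

theorem besselCoeff_eq_mul (ν : ℂ) (k : ℕ) :
    besselCoeff ν k = (k + ν + 1) * besselCoeff (ν + 1) k := by
  simp only [besselCoeff]
  rw [Complex.one_div_Gamma_eq_self_mul_one_div_Gamma_add_one (k + ν + 1),
    show (k : ℂ) + (ν + 1) + 1 = k + ν + 1 + 1 by ring]
  ring

theorem summable_besselCoeff_mul_pow (ν y : ℂ) :
    Summable fun k : ℕ => besselCoeff ν k * y ^ k := by
  refine summable_of_ratio_norm_eventually_le (r := 1 / 2) (by norm_num) ?_
  have hlim : Tendsto (fun k : ℕ => (k : ℝ)) atTop atTop := tendsto_natCast_atTop_atTop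
  filter_upwards [hlim.eventually_ge_atTop (2 * ‖y‖), hlim.eventually_ge_atTop (‖ν + 1‖ + 1)]
    with k hk hk'
  have hrec : besselCoeff ν k = (k + ν + 1) * ((k + 1) * besselCoeff ν (k + 1)) := by
    rw [succ_mul_besselCoeff_succ, besselCoeff_eq_mul]
  have h1 : ‖(k : ℂ) + 1‖ = k + 1 := by
    exact_mod_cast Complex.norm_natCast (k + 1)
  have h2 : 1 ≤ ‖(k : ℂ) + ν + 1‖ := by
    have := norm_sub_le ((k : ℂ) + ν + 1) (ν + 1)
    rw [show (k : ℂ) + ν + 1 - (ν + 1) = k by ring, Complex.norm_natCast] at this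
    linarith
  rw [hrec]
  simp only [norm_mul, norm_pow, h1]
  rw [pow_succ]
  have h3 : 2 * ‖y‖ ≤ ‖(k : ℂ) + ν + 1‖ * (k + 1) := by nlinarith [norm_nonneg y]
  have h4 : 0 ≤ ‖besselCoeff ν (k + 1)‖ * ‖y‖ ^ k := by positivity
  nlinarith [mul_le_mul_of_nonneg_left h3 h4]

theorem hasDerivAt_besselEntire (ν y : ℂ) :
    HasDerivAt (besselEntire ν) (besselEntire (ν + 1) y) y := by
  have hR : ‖((‖y‖ + 1 : ℝ) : ℂ)‖ = ‖y‖ + 1 := Complex.norm_of_nonneg (by positivity)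
  have hshift (z : ℂ) (n : ℕ) :
      besselCoeff ν (n + 1) * (((n + 1 : ℕ) : ℂ) * z ^ (n + 1 - 1)) =
        besselCoeff (ν + 1) n * z ^ n := by
    rw [← succ_mul_besselCoeff_succ]
    push_cast
    ring
  have hsum (z : ℂ) : Summable fun n : ℕ => besselCoeff ν n * ((n : ℂ) * z ^ (n - 1)) := by
    refine (summable_nat_add_iff 1).1 ?_
    simpa only [hshift] using summable_besselCoeff_mul_pow (ν + 1) z
  have key := hasDerivAt_tsum_of_isPreconnected (y₀ := y) (y := y)
    (g := fun (n : ℕ) z => besselCoeff ν n * z ^ n)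
    (g' := fun (n : ℕ) z => besselCoeff ν n * ((n : ℂ) * z ^ (n - 1)))
    (hsum ((‖y‖ + 1 : ℝ) : ℂ)).norm Metric.isOpen_ball
    (convex_ball (0 : ℂ) (‖y‖ + 1)).isPreconnected
    (fun n z _ => (hasDerivAt_pow n z).const_mul _)
    (fun n z hz => by
      have hz' : ‖z‖ ≤ ‖y‖ + 1 := (mem_ball_zero_iff.1 hz).le
      simp only [norm_mul, norm_pow, hR]
      gcongr)
    (by simp) (summable_besselCoeff_mul_pow ν y) (by simp)
  rw [(hsum y).tsum_eq_zero_add] at key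
  simp only [hshift, Nat.cast_zero, zero_mul, mul_zero, zero_add] at key
  exact key

theorem continuous_besselEntire (ν : ℂ) : Continuous (besselEntire ν) :=
  continuous_iff_continuousAt.2 fun y => (hasDerivAt_besselEntire ν y).continuousAt

theorem besselEntire_recurrence (ν y : ℂ) :
    y * besselEntire (ν + 2) y + (ν + 1) * besselEntire (ν + 1) y = besselEntire ν y := by
  have h1 := summable_besselCoeff_mul_pow (ν + 1) y
  have h2 : Summable fun k : ℕ => (k : ℂ) * besselCoeff (ν + 1) k * y ^ k := by
    refine ((summable_besselCoeff_mul_pow ν y).sub (h1.mul_left (ν + 1))).congr fun k => ?_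
    rw [besselCoeff_eq_mul]
    ring
  have h3 : ∑' k : ℕ, (k : ℂ) * besselCoeff (ν + 1) k * y ^ k = y * besselEntire (ν + 2) y := by
    rw [h2.tsum_eq_zero_add, besselEntire, ← tsum_mul_left]
    simp only [Nat.cast_zero, zero_mul, zero_add]
    refine tsum_congr fun k => ?_
    rw [show ν + 2 = ν + 1 + 1 by ring, ← succ_mul_besselCoeff_succ (ν + 1)]
    push_cast
    ring
  rw [← h3, besselEntire, ← tsum_mul_left, ← h2.tsum_add (h1.mul_left _), besselEntire]
  refine tsum_congr fun k => ?_
  rw [besselCoeff_eq_mul ν]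
  ring

/-- The function `√r * besselI ν (ω r)`, see `sqrt_mul_besselI`. -/
noncomputable def besselSol (ν ω z : ℂ) : ℂ :=
  (ω / 2) ^ ν * z ^ (ν + 1 / 2) * besselEntire ν (ω ^ 2 / 4 * z ^ 2)

/-- The derivative of `besselSol`. -/
noncomputable def besselSolDeriv (ν ω z : ℂ) : ℂ :=
  (ω / 2) ^ ν * z ^ (ν + 1 / 2) *
    ((ν + 1 / 2) / z * besselEntire ν (ω ^ 2 / 4 * z ^ 2) +
      ω ^ 2 / 2 * z * besselEntire (ν + 1) (ω ^ 2 / 4 * z ^ 2))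

theorem sqrt_mul_besselI (ν : ℂ) {ω : ℂ} (hω : ω ≠ 0) {r : ℝ} (hr : 0 < r) :
    (√r : ℂ) * besselI ν (ω * r) = besselSol ν ω r := by
  have hr' : (r : ℂ) ≠ 0 := Complex.ofReal_ne_zero.2 hr.ne'
  have hz : ω * r / 2 ≠ 0 := by simp [hω, hr']
  have hsqrt : (√r : ℂ) = (r : ℂ) ^ (1 / 2 : ℂ) := by
    rw [Real.sqrt_eq_rpow, Complex.ofReal_cpow hr.le]
    norm_num
  have hpow : (ω * r / 2) ^ ν = (ω / 2) ^ ν * (r : ℂ) ^ ν := by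
    have hω2 : ω / 2 ≠ 0 := by simp [hω]
    rw [show ω * r / 2 = (r : ℂ) * (ω / 2) by ring, Complex.cpow_def_of_ne_zero hω2,
      Complex.cpow_def_of_ne_zero hr', Complex.cpow_def_of_ne_zero (mul_ne_zero hr' hω2),
      Complex.log_ofReal_mul hr hω2, ← Complex.exp_add, Complex.ofReal_log hr.le]
    ring_nf
  have hterm (k : ℕ) : (ω * r / 2) ^ (ν + 2 * (k : ℂ)) /
      (Complex.Gamma (k + ν + 1) * (Nat.factorial k : ℂ)) =
      (ω / 2) ^ ν * (r : ℂ) ^ ν * (besselCoeff ν k * (ω ^ 2 / 4 * (r : ℂ) ^ 2) ^ k) := by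
    rw [Complex.cpow_add _ _ hz, hpow, show (2 : ℂ) * k = ((2 * k : ℕ) : ℂ) by push_cast; rfl,
      Complex.cpow_natCast, pow_mul, besselCoeff, div_eq_mul_inv, mul_inv,
      show (ω * r / 2) ^ 2 = ω ^ 2 / 4 * (r : ℂ) ^ 2 by ring]
    ring
  simp only [besselI, hterm, tsum_mul_left, besselSol, besselEntire]
  rw [Complex.cpow_add _ _ hr', hsqrt]
  ring

theorem hasDerivAt_cpow_and_besselEntire (ν ω : ℂ) {z : ℂ} (hz : z ∈ Complex.slitPlane) :
    HasDerivAt (fun z : ℂ => z ^ (ν + 1 / 2)) (z ^ (ν + 1 / 2) * ((ν + 1 / 2) / z)) z ∧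
    HasDerivAt (fun z : ℂ => besselEntire ν (ω ^ 2 / 4 * z ^ 2))
      (besselEntire (ν + 1) (ω ^ 2 / 4 * z ^ 2) * (ω ^ 2 / 2 * z)) z := by
  have hz0 : z ≠ 0 := Complex.slitPlane_ne_zero hz
  constructor
  · refine ((hasDerivAt_id z).cpow_const hz).congr_deriv ?_
    simp only [id]
    rw [Complex.cpow_sub _ _ hz0, Complex.cpow_one]
    ring
  · refine ((hasDerivAt_besselEntire ν _).comp z
      ((hasDerivAt_pow 2 z).const_mul (ω ^ 2 / 4))).congr_deriv ?_
    push_cast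
    ring

theorem hasDerivAt_besselSol (ν ω : ℂ) {r : ℝ} (hr : 0 < r) :
    HasDerivAt (fun r : ℝ => besselSol ν ω r) (besselSolDeriv ν ω r) r := by
  have hz : (r : ℂ) ∈ Complex.slitPlane := Complex.ofReal_mem_slitPlane.2 hr
  obtain ⟨h1, h2⟩ := hasDerivAt_cpow_and_besselEntire ν ω hz
  refine HasDerivAt.comp_ofReal (e := besselSol ν ω) ?_
  refine ((h1.const_mul ((ω / 2) ^ ν)).mul h2).congr_deriv ?_
  simp only [besselSolDeriv]
  ring

theorem hasDerivAt_besselSolDeriv (ν ω : ℂ) {r : ℝ} (hr : 0 < r) :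
    HasDerivAt (fun r : ℝ => besselSolDeriv ν ω r)
      ((ω ^ 2 + (ν ^ 2 - 1 / 4) / (r : ℂ) ^ 2) * besselSol ν ω r) r := by
  have hz : (r : ℂ) ∈ Complex.slitPlane := Complex.ofReal_mem_slitPlane.2 hr
  have hz0 : (r : ℂ) ≠ 0 := Complex.slitPlane_ne_zero hz
  obtain ⟨h1, h2⟩ := hasDerivAt_cpow_and_besselEntire ν ω hz
  have h3 := (hasDerivAt_cpow_and_besselEntire (ν + 1) ω hz).2
  have h4 : HasDerivAt (fun z : ℂ => (ν + 1 / 2) / z) (-(ν + 1 / 2) / (r : ℂ) ^ 2) (r : ℂ) := by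
    refine ((hasDerivAt_inv hz0).const_mul (ν + 1 / 2)).congr_deriv ?_
    ring
  have h5 : HasDerivAt (fun z : ℂ => ω ^ 2 / 2 * z) (ω ^ 2 / 2) (r : ℂ) := by
    simpa using (hasDerivAt_id (r : ℂ)).const_mul (ω ^ 2 / 2)
  refine HasDerivAt.comp_ofReal (e := besselSolDeriv ν ω) ?_
  refine ((h1.const_mul ((ω / 2) ^ ν)).mul ((h4.mul h2).add (h5.mul h3))).congr_deriv ?_
  simp only [besselSol, Pi.add_apply, Pi.mul_apply]
  rw [show ν + 1 + 1 = ν + 2 by ring, ← besselEntire_recurrence ν]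
  field_simp
  ring

/-- Energy estimate for the equation `f'' = (ω² - c / r²) f` with `ω` in the right half of
the unit circle. -/
theorem energy_le_of_hasDerivAt {f f' : ℝ → ℂ} {ω : ℂ} {c s r : ℝ} (hω : ‖ω‖ = 1)
    (hre : 0 ≤ ω.re) (hc : 0 ≤ c) (hs : 0 < s) (hsr : s ≤ r)
    (hf : ∀ x : ℝ, 0 < x → HasDerivAt f (f' x) x)
    (hf' : ∀ x : ℝ, 0 < x → HasDerivAt f' ((ω ^ 2 + (-c : ℝ) / (x : ℂ) ^ 2) * f x) x) :
    ‖f r‖ ^ 2 + ‖f' r‖ ^ 2 ≤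
      (‖f s‖ ^ 2 + ‖f' s‖ ^ 2) * Real.exp (2 * (ω.re * (r - s)) + c / s) := by
  set E : ℝ → ℝ := fun x => ‖f x‖ ^ 2 + ‖f' x‖ ^ 2 with hE
  set w : ℝ → ℝ := fun x => Real.exp (-2 * ω.re * x + c * x⁻¹) with hw
  have hω2 : ω.re ^ 2 + ω.im ^ 2 = 1 := by
    have := Complex.sq_norm ω
    rw [hω, Complex.normSq_apply] at this
    nlinarith
  have hderiv (x : ℝ) (hx : 0 < x) : ∃ d, HasDerivAt (fun x => E x * w x) d x ∧ d ≤ 0 := by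
    have h1 : HasDerivAt E (2 * inner ℝ (f x) (f' x) +
        2 * inner ℝ (f' x) ((ω ^ 2 + (-c : ℝ) / (x : ℂ) ^ 2) * f x)) x :=
      (hf x hx).norm_sq.add (hf' x hx).norm_sq
    have h2 : HasDerivAt w (w x * (-2 * ω.re + c * (-(x ^ 2)⁻¹))) x := by
      refine HasDerivAt.exp (((hasDerivAt_id x).const_mul (-2 * ω.re)).add
        ((hasDerivAt_inv hx.ne').const_mul c)) |>.congr_deriv ?_
      simp only [id, mul_one, hw, Pi.add_apply]
    refine ⟨_, h1.mul h2, ?_⟩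
    have hV : ω ^ 2 + (-c : ℝ) / (x : ℂ) ^ 2 = ω ^ 2 - ((c * (x ^ 2)⁻¹ : ℝ) : ℂ) := by
      push_cast
      ring
    have hVnn : 0 ≤ c * (x ^ 2)⁻¹ := by positivity
    rw [hV]
    set V := c * (x ^ 2)⁻¹
    have hbound : 2 * inner ℝ (f x) (f' x) +
        2 * inner ℝ (f' x) ((ω ^ 2 - (V : ℂ)) * f x) ≤ (2 * ω.re + V) * E x := by
      simp only [hE, Complex.sq_norm]
      simp only [Complex.normSq_apply, Complex.inner, Complex.mul_re,
        Complex.mul_im, Complex.sub_re, Complex.sub_im, Complex.ofReal_re, Complex.ofReal_im,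
        Complex.conj_re, Complex.conj_im, pow_two]
      generalize (f x).re = a, (f x).im = b, (f' x).re = p, (f' x).im = q
      generalize ω.re = u, ω.im = v at *
      have h3 : 2 * (a * (u * p + v * q) + b * (u * q - v * p)) ≤
          a * a + b * b + (p * p + q * q) := by
        have : (u * p + v * q) ^ 2 + (u * q - v * p) ^ 2 = p * p + q * q := by
          linear_combination (p ^ 2 + q ^ 2) * hω2
        nlinarith [sq_nonneg (a - (u * p + v * q)), sq_nonneg (b - (u * q - v * p))]
      have h4 : -2 * (a * p + b * q) ≤ a * a + b * b + (p * p + q * q) := by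
        nlinarith [sq_nonneg (a + p), sq_nonneg (b + q)]
      have h5 := mul_le_mul_of_nonneg_left h3 hre
      have h6 := mul_le_mul_of_nonneg_left h4 hVnn
      have h7 : v ^ 2 = 1 - u ^ 2 := by linarith
      have h8 : (v ^ 2 - (1 - u ^ 2)) * (a * p + b * q) = 0 := by rw [h7]; ring
      nlinarith
    have hwpos : 0 < w x := Real.exp_pos _
    nlinarith [mul_le_mul_of_nonneg_right hbound hwpos.le]
  have hanti : AntitoneOn (fun x => E x * w x) (Set.Ioi 0) := by
    refine antitoneOn_of_deriv_nonpos (convex_Ioi 0) ?_ ?_ ?_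
    · intro x hx
      obtain ⟨d, hd, -⟩ := hderiv x hx
      exact hd.continuousAt.continuousWithinAt
    · intro x hx
      obtain ⟨d, hd, -⟩ := hderiv x (interior_subset hx)
      exact hd.differentiableAt.differentiableWithinAt
    · intro x hx
      obtain ⟨d, hd, hd0⟩ := hderiv x (interior_subset hx)
      rwa [hd.deriv]
  have hr : 0 < r := hs.trans_le hsr
  have hle : E r * w r ≤ E s * w s := hanti hs hr hsr
  have hEs : 0 ≤ E s := by positivity
  calc E r = E r * w r * Real.exp (2 * ω.re * r - c * r⁻¹) := by
        rw [mul_assoc, hw, ← Real.exp_add]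
        ring_nf
        simp
    _ ≤ E s * w s * Real.exp (2 * ω.re * r - c * r⁻¹) := by gcongr
    _ = E s * Real.exp (2 * (ω.re * (r - s)) + c / s - c * r⁻¹) := by
        rw [mul_assoc, hw, ← Real.exp_add]
        ring_nf
    _ ≤ E s * Real.exp (2 * (ω.re * (r - s)) + c / s) := by
        gcongr
        have : 0 ≤ c * r⁻¹ := by positivity
        linarith

theorem exists_besselSol_bound {ν : ℂ} (hν : ν.re = 0) :
    ∃ M : ℝ, 0 < M ∧ ∀ ω : ℂ, ‖ω‖ = 1 →
      (∀ r : ℝ, 0 < r → r ≤ 1 → ‖besselSol ν ω r‖ ≤ M * √r) ∧ ‖besselSolDeriv ν ω 1‖ ≤ M := by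
  obtain ⟨B, hB⟩ := (isCompact_closedBall (0 : ℂ) (1 / 4)).exists_bound_of_continuousOn
    (continuous_besselEntire ν).continuousOn
  obtain ⟨B', hB'⟩ := (isCompact_closedBall (0 : ℂ) (1 / 4)).exists_bound_of_continuousOn
    (continuous_besselEntire (ν + 1)).continuousOn
  have hB0 : 0 ≤ B := (norm_nonneg _).trans (hB 0 (by simp))
  have hB0' : 0 ≤ B' := (norm_nonneg _).trans (hB' 0 (by simp))
  set A := Real.exp (Real.pi * |ν.im|)
  have hA : ∀ ω : ℂ, ‖ω‖ = 1 → ‖(ω / 2) ^ ν‖ ≤ A := by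
    intro ω hω
    refine (Complex.norm_cpow_le _ _).trans ?_
    rw [hν, Real.rpow_zero, one_div, ← Real.exp_neg]
    refine Real.exp_le_exp.2 ((neg_le_abs _).trans ?_)
    rw [abs_mul]
    gcongr
    exact Complex.abs_arg_le_pi _
  have hball {ω : ℂ} (hω : ‖ω‖ = 1) {r : ℝ} (hr : 0 < r) (hr1 : r ≤ 1) :
      ω ^ 2 / 4 * (r : ℂ) ^ 2 ∈ Metric.closedBall (0 : ℂ) (1 / 4) := by
    rw [mem_closedBall_zero_iff]
    simp only [norm_mul, norm_div, norm_pow, hω, Complex.norm_of_nonneg hr.le, Complex.norm_ofNat]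
    have : r ^ 2 ≤ 1 := pow_le_one₀ hr.le hr1
    linarith
  refine ⟨A * (1 + B + ‖ν + 1 / 2‖ * B + 1 / 2 * B'), by positivity, fun ω hω => ⟨?_, ?_⟩⟩
  · intro r hr hr1
    have hp : ‖(r : ℂ) ^ (ν + 1 / 2)‖ = √r := by
      rw [Complex.norm_cpow_eq_rpow_re_of_pos hr, Real.sqrt_eq_rpow]
      simp [hν]
    rw [besselSol, norm_mul, norm_mul, hp]
    calc _ ≤ A * √r * B := by
          gcongr
          · exact hA ω hω
          · exact hB _ (hball hω hr hr1)
      _ = A * B * √r := by ring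
      _ ≤ _ := by
          gcongr
          have : 0 ≤ ‖ν + 1 / 2‖ * B := by positivity
          linarith
  · have h1 := hball hω one_pos le_rfl
    rw [Complex.ofReal_one] at h1
    rw [besselSolDeriv, norm_mul, Complex.one_cpow, mul_one]
    gcongr
    · exact hA ω hω
    · refine (norm_add_le _ _).trans ?_
      simp only [norm_mul, norm_div, norm_pow, hω, norm_one]
      have h2 := mul_le_mul_of_nonneg_left (hB _ h1) (norm_nonneg (ν + 1 / 2))
      have h3 := hB' _ h1
      norm_num at h2 h3 ⊢
      linarith

theorem half_le_sqrt_div {r : ℝ} (hr : 1 ≤ r) : 1 / 2 ≤ √(r / (1 + r)) := by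
  refine Real.le_sqrt_of_sq_le ?_
  rw [le_div_iff₀ (by linarith)]
  linarith

theorem sqrt_le_two_mul_sqrt_div {r : ℝ} (hr : 0 ≤ r) (hr1 : r ≤ 1) :
    √r ≤ 2 * √(r / (1 + r)) := by
  rw [Real.sqrt_le_left (by positivity), mul_pow, Real.sq_sqrt (by positivity), mul_div_assoc',
    le_div_iff₀ (by linarith)]
  nlinarith

theorem norm_le_of_energy {f f' : ℝ → ℂ} {ω : ℂ} {c s r M : ℝ} (hω : ‖ω‖ = 1)
    (hre : 0 ≤ ω.re) (hc : 0 ≤ c) (hs : 0 < s) (hs1 : s ≤ 1) (hsr : s ≤ r) (hM : 0 < M)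
    (hf : ∀ x : ℝ, 0 < x → HasDerivAt f (f' x) x)
    (hf' : ∀ x : ℝ, 0 < x → HasDerivAt f' ((ω ^ 2 + (-c : ℝ) / (x : ℂ) ^ 2) * f x) x)
    (hsmall : ∀ x : ℝ, 0 < x → x ≤ 1 → ‖f x‖ ≤ M * √x) (hone : ‖f' 1‖ ≤ M) :
    ‖f r‖ ≤ 4 * M * Real.exp c * √(r / (1 + r)) * Real.exp (ω.re * (r - s)) := by
  have hr : 0 < r := hs.trans_le hsr
  have hec : 1 ≤ Real.exp c := Real.one_le_exp hc
  have hexp : 1 ≤ Real.exp (ω.re * (r - s)) :=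
    Real.one_le_exp (mul_nonneg hre (sub_nonneg.2 hsr))
  rcases le_total r 1 with hr1 | hr1
  · calc ‖f r‖ ≤ M * √r := hsmall r hr hr1
      _ ≤ M * (2 * √(r / (1 + r))) := by
          gcongr
          exact sqrt_le_two_mul_sqrt_div hr.le hr1
      _ = 2 * M * 1 * √(r / (1 + r)) * 1 := by ring
      _ ≤ _ := by
          gcongr
          norm_num
  · have hE := energy_le_of_hasDerivAt hω hre hc one_pos hr1 hf hf'
    have h1 : ‖f 1‖ ≤ M := by simpa using hsmall 1 one_pos le_rfl
    have h2 : ‖f r‖ ≤ 2 * M * Real.exp c * Real.exp (ω.re * (r - s)) := by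
      refine (abs_le_of_sq_le_sq' ?_ (by positivity)).2
      calc ‖f r‖ ^ 2 ≤ ‖f r‖ ^ 2 + ‖f' r‖ ^ 2 := le_add_of_nonneg_right (by positivity)
        _ ≤ (M ^ 2 + M ^ 2) * Real.exp (2 * (ω.re * (r - s)) + 2 * c) := by
            refine hE.trans ?_
            gcongr
            rw [div_one]
            linarith
        _ = 2 * M ^ 2 * (Real.exp c * Real.exp (ω.re * (r - s))) ^ 2 := by
            rw [← Real.exp_add, ← Real.exp_nat_mul]
            push_cast
            ring_nf
        _ ≤ 4 * M ^ 2 * (Real.exp c * Real.exp (ω.re * (r - s))) ^ 2 := by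
            gcongr
            norm_num
        _ = _ := by ring
    calc ‖f r‖ ≤ 4 * M * Real.exp c * (1 / 2) * Real.exp (ω.re * (r - s)) := by
          refine h2.trans_eq ?_
          ring
      _ ≤ _ := by
          gcongr
          exact half_le_sqrt_div hr1

/-- Bound for the unnormalised Green kernel `f(r) g(s) - f(s) g(r)` of the equation
`f'' = (ω² - c / r²) f`, in terms of bounds on the solutions `f`, `g` near the origin. -/
theorem norm_cross_le {f f' g g' : ℝ → ℂ} {ω : ℂ} {c s r M : ℝ} (hω : ‖ω‖ = 1)
    (hre : 0 ≤ ω.re) (hc : 0 ≤ c) (hs : 0 < s) (hsr : s ≤ r) (hM : 0 < M)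
    (hf : ∀ x : ℝ, 0 < x → HasDerivAt f (f' x) x)
    (hf' : ∀ x : ℝ, 0 < x → HasDerivAt f' ((ω ^ 2 + (-c : ℝ) / (x : ℂ) ^ 2) * f x) x)
    (hg : ∀ x : ℝ, 0 < x → HasDerivAt g (g' x) x)
    (hg' : ∀ x : ℝ, 0 < x → HasDerivAt g' ((ω ^ 2 + (-c : ℝ) / (x : ℂ) ^ 2) * g x) x)
    (hfs : ∀ x : ℝ, 0 < x → x ≤ 1 → ‖f x‖ ≤ M * √x) (hf1 : ‖f' 1‖ ≤ M)
    (hgs : ∀ x : ℝ, 0 < x → x ≤ 1 → ‖g x‖ ≤ M * √x) (hg1 : ‖g' 1‖ ≤ M) :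
    ‖f r * g s - f s * g r‖ ≤ 32 * M ^ 2 * Real.exp c ^ 2 * √(r / (1 + r)) * √(s / (1 + s)) *
      Real.exp (ω.re * (r - s)) := by
  rcases le_total s 1 with hs1 | hs1
  · have h1 := norm_le_of_energy hω hre hc hs hs1 hsr hM hf hf' hfs hf1
    have h2 := norm_le_of_energy hω hre hc hs hs1 hsr hM hg hg' hgs hg1
    have h3 := norm_le_of_energy hω hre hc hs hs1 le_rfl hM hf hf' hfs hf1
    have h4 := norm_le_of_energy hω hre hc hs hs1 le_rfl hM hg hg' hgs hg1
    simp only [sub_self, mul_zero, Real.exp_zero, mul_one] at h3 h4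
    refine (norm_sub_le _ _).trans ?_
    rw [norm_mul, norm_mul]
    refine (add_le_add (mul_le_mul h1 h4 (norm_nonneg _) (by positivity))
      (mul_le_mul h3 h2 (norm_nonneg _) (by positivity))).trans_eq ?_
    ring
  · set W : ℝ → ℂ := fun x => f' x * g x - f x * g' x with hW
    have hWd (x : ℝ) (hx : 0 < x) : HasDerivAt W 0 x := by
      refine (((hf' x hx).mul (hg x hx)).sub ((hf x hx).mul (hg' x hx))).congr_deriv ?_
      ring
    have hWs : W s = W 1 := by
      refine (convex_Ioi (0 : ℝ)).is_const_of_fderivWithin_eq_zero (𝕜 := ℝ) (f := W) ?_ ?_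
        hs (Set.mem_Ioi.2 one_pos)
      · exact fun x hx => (hWd x hx).differentiableAt.differentiableWithinAt
      · intro x hx
        rw [fderivWithin_of_isOpen isOpen_Ioi hx]
        have := (hWd x hx).hasFDerivAt.fderiv
        simpa using this
    have hf1' : ‖f 1‖ ≤ M := by simpa using hfs 1 one_pos le_rfl
    have hg1' : ‖g 1‖ ≤ M := by simpa using hgs 1 one_pos le_rfl
    have hWb : ‖W s‖ ≤ 2 * M ^ 2 := by
      rw [hWs]
      refine (norm_sub_le _ _).trans ?_
      rw [norm_mul, norm_mul]
      refine (add_le_add (mul_le_mul hf1 hg1' (norm_nonneg _) hM.le)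
        (mul_le_mul hf1' hg1 (norm_nonneg _) hM.le)).trans_eq ?_
      ring
    have hE := energy_le_of_hasDerivAt (f := fun x => f x * g s - f s * g x)
      (f' := fun x => f' x * g s - f s * g' x) hω hre hc hs hsr
      (fun x hx => ((hf x hx).mul_const _).sub ((hg x hx).const_mul _))
      (fun x hx => (((hf' x hx).mul_const _).sub ((hg' x hx).const_mul _)).congr_deriv (by ring))
    have h0 : f s * g s - f s * g s = 0 := sub_self _
    simp only [h0, norm_zero] at hE
    have hcs : c / s ≤ 2 * c := by
      rw [div_le_iff₀ hs]
      nlinarith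
    have h1 : ‖f r * g s - f s * g r‖ ≤
        2 * M ^ 2 * (Real.exp c * Real.exp (ω.re * (r - s))) := by
      refine (abs_le_of_sq_le_sq' ?_ (by positivity)).2
      calc _ ≤ ‖f r * g s - f s * g r‖ ^ 2 + ‖f' r * g s - f s * g' r‖ ^ 2 :=
            le_add_of_nonneg_right (by positivity)
        _ ≤ _ := hE
        _ ≤ (0 ^ 2 + (2 * M ^ 2) ^ 2) * Real.exp (2 * (ω.re * (r - s)) + 2 * c) := by
            gcongr
        _ = _ := by
            rw [← Real.exp_add, mul_pow _ (Real.exp _), ← Real.exp_nat_mul]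
            push_cast
            ring_nf
    have hec : Real.exp c ≤ Real.exp c ^ 2 := by
      have := Real.one_le_exp hc
      nlinarith
    calc _ ≤ 2 * M ^ 2 * (Real.exp c * Real.exp (ω.re * (r - s))) := h1
      _ = 8 * M ^ 2 * Real.exp c * (1 / 2) * (1 / 2) * Real.exp (ω.re * (r - s)) := by ring
      _ ≤ _ := by
          gcongr
          · norm_num
          · exact half_le_sqrt_div (hs1.trans hsr)
          · exact half_le_sqrt_div hs1

theorem greenKernel_eq (lam : ℝ) {x t : ℝ} {μ : ℂ} (hμ : μ ≠ 0) (ht : 0 < t) (hx : 0 < x) :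
    greenKernel lam x t μ =
      (Real.pi / 2 : ℂ) / Complex.sin (Complex.I * lam * Real.pi) * ((‖μ‖⁻¹ : ℝ) : ℂ) *
        (besselSol (Complex.I * lam) (μ / ‖μ‖) (‖μ‖ * x : ℝ) *
            besselSol (-(Complex.I * lam)) (μ / ‖μ‖) (‖μ‖ * t : ℝ) -
          besselSol (Complex.I * lam) (μ / ‖μ‖) (‖μ‖ * t : ℝ) *
            besselSol (-(Complex.I * lam)) (μ / ‖μ‖) (‖μ‖ * x : ℝ)) := by
  have hn : 0 < ‖μ‖ := norm_pos_iff.2 hμ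
  have hn' : (‖μ‖ : ℂ) ≠ 0 := Complex.ofReal_ne_zero.2 hn.ne'
  have hω : μ / ‖μ‖ ≠ 0 := div_ne_zero hμ hn'
  have harg (y : ℝ) : μ / ‖μ‖ * ((‖μ‖ * y : ℝ) : ℂ) = μ * y := by
    push_cast
    field_simp
  have hsq : (√(x * t) : ℂ) = ((‖μ‖⁻¹ : ℝ) : ℂ) * (√(‖μ‖ * x) * √(‖μ‖ * t)) := by
    rw [← Complex.ofReal_mul, ← Complex.ofReal_mul, ← Real.sqrt_mul (by positivity),
      show ‖μ‖ * x * (‖μ‖ * t) = ‖μ‖ ^ 2 * (x * t) by ring, Real.sqrt_mul (sq_nonneg ‖μ‖),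
      Real.sqrt_sq hn.le, inv_mul_cancel_left₀ hn.ne']
  rw [← sqrt_mul_besselI _ hω (mul_pos hn hx), ← sqrt_mul_besselI _ hω (mul_pos hn hx),
    ← sqrt_mul_besselI _ hω (mul_pos hn ht), ← sqrt_mul_besselI _ hω (mul_pos hn ht),
    harg, harg, greenKernel, hsq, besselK, besselK]
  ring

theorem sqrt_div_one_add_mul {a x : ℝ} (ha : 0 < a) (hx : 0 < x) :
    √(x / (1 + a * x)) = √(a⁻¹) * √(a * x / (1 + a * x)) := by
  rw [← Real.sqrt_mul (by positivity)]
  congr 1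
  field_simp

/-- Estimate on the Green kernel: for every `λ ≠ 0` there is `C > 0` such that
for all `μ` with `Re μ ≥ 0`, `μ ≠ 0`, and all `0 < t ≤ x`,
`|G(x,t,μ)| ≤ C (x/(1+|μ|x))^{1/2} (t/(1+|μ|t))^{1/2} e^{Re(μ)(x−t)}`. -/
theorem stmt1 (lam : ℝ) (hlam : lam ≠ 0) :
    ∃ C : ℝ, 0 < C ∧ ∀ μ : ℂ, 0 ≤ μ.re → μ ≠ 0 → ∀ x t : ℝ, 0 < t → t ≤ x →
      ‖greenKernel lam x t μ‖ ≤
        C * Real.sqrt (x / (1 + ‖μ‖ * x)) * Real.sqrt (t / (1 + ‖μ‖ * t)) *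
          Real.exp (μ.re * (x - t)) := by
  obtain ⟨M₁, hM₁, hb₁⟩ := exists_besselSol_bound (ν := Complex.I * lam) (by simp)
  obtain ⟨M₂, hM₂, hb₂⟩ := exists_besselSol_bound (ν := -(Complex.I * lam)) (by simp)
  set κ : ℂ := (Real.pi / 2 : ℂ) / Complex.sin (Complex.I * lam * Real.pi) with hκ
  set c : ℝ := lam ^ 2 + 1 / 4 with hc
  set M : ℝ := max M₁ M₂ with hM
  have hM0 : 0 < M := lt_max_of_lt_left hM₁
  refine ⟨(‖κ‖ + 1) * (32 * M ^ 2 * Real.exp c ^ 2), by positivity, ?_⟩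
  intro μ hμre hμ x t ht htx
  have hx : 0 < x := ht.trans_le htx
  have hn : 0 < ‖μ‖ := norm_pos_iff.2 hμ
  have hω : ‖μ / ‖μ‖‖ = 1 := by
    rw [norm_div, Complex.norm_of_nonneg hn.le, div_self hn.ne']
  have hre : (μ / ‖μ‖).re = μ.re / ‖μ‖ := Complex.div_ofReal_re _ _
  have hcoeff {ν : ℂ} (hν : ν ^ 2 = -(lam : ℂ) ^ 2) : ν ^ 2 - 1 / 4 = ((-c : ℝ) : ℂ) := by
    rw [hν, hc]
    push_cast
    ring
  have hν₁ : (Complex.I * lam) ^ 2 = -(lam : ℂ) ^ 2 := by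
    rw [mul_pow, Complex.I_sq]
    ring
  have hν₂ : (-(Complex.I * lam)) ^ 2 = -(lam : ℂ) ^ 2 := by rw [neg_sq, hν₁]
  have key := norm_cross_le (c := c) (M := M) hω (by rw [hre]; positivity) (by positivity)
    (mul_pos hn ht) (mul_le_mul_of_nonneg_left htx hn.le) hM0
    (fun y hy => hasDerivAt_besselSol (Complex.I * lam) (μ / ‖μ‖) hy)
    (fun y hy => by
      rw [← hcoeff hν₁]
      exact hasDerivAt_besselSolDeriv (Complex.I * lam) (μ / ‖μ‖) hy)
    (fun y hy => hasDerivAt_besselSol (-(Complex.I * lam)) (μ / ‖μ‖) hy)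
    (fun y hy => by
      rw [← hcoeff hν₂]
      exact hasDerivAt_besselSolDeriv (-(Complex.I * lam)) (μ / ‖μ‖) hy)
    (fun y hy hy1 => ((hb₁ _ hω).1 y hy hy1).trans (by gcongr; exact le_max_left _ _))
    (by rw [Complex.ofReal_one]; exact (hb₁ _ hω).2.trans (le_max_left _ _))
    (fun y hy hy1 => ((hb₂ _ hω).1 y hy hy1).trans (by gcongr; exact le_max_right _ _))
    (by rw [Complex.ofReal_one]; exact (hb₂ _ hω).2.trans (le_max_right _ _))
  have hexp : (μ / ‖μ‖).re * (‖μ‖ * x - ‖μ‖ * t) = μ.re * (x - t) := by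
    rw [hre]
    field_simp
  rw [hexp] at key
  rw [greenKernel_eq lam hμ ht hx, ← hκ, norm_mul, norm_mul, sqrt_div_one_add_mul hn hx,
    sqrt_div_one_add_mul hn ht, Complex.norm_of_nonneg (by positivity)]
  calc _ ≤ (‖κ‖ + 1) * ‖μ‖⁻¹ * (32 * M ^ 2 * Real.exp c ^ 2 *
        √(‖μ‖ * x / (1 + ‖μ‖ * x)) * √(‖μ‖ * t / (1 + ‖μ‖ * t)) *
          Real.exp (μ.re * (x - t))) := by
        gcongr
        linarith
    _ = (‖κ‖ + 1) * (√(‖μ‖⁻¹) * √(‖μ‖⁻¹)) * (32 * M ^ 2 * Real.exp c ^ 2 *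
        √(‖μ‖ * x / (1 + ‖μ‖ * x)) * √(‖μ‖ * t / (1 + ‖μ‖ * t)) *
          Real.exp (μ.re * (x - t))) := by
        rw [Real.mul_self_sqrt (by positivity)]
    _ = _ := by ring
end

section
/- Let λ ∈ ℝ \ {0} and define g₁(x,μ) = Γ(1−iλ)·(μ/2)^{iλ}·√x·I_{−iλ}(μx) and g₂(x,μ) = (1/(2iλ))·Γ(1+iλ)·(μ/2)^{−iλ}·√x·I_{iλ}(μx). Then there exists a constant C > 0 such that for all real x > 0 and all μ ∈ ℂ with Re(μ) ≥ 0 and μ ≠ 0, one has |g_j(x,μ)| ≤ C · (x/(1+|μ|x))^{1/2} · e^{Re(μ)·x} for j = 1, 2. -/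
open Filter

/-- `g₁(x,μ) = Γ(1−iλ)·(μ/2)^{iλ}·√x·I_{−iλ}(μx)`. -/
noncomputable def g1 (lam : ℝ) (x : ℝ) (μ : ℂ) : ℂ :=
  Complex.Gamma (1 - Complex.I * lam) * (μ / 2) ^ (Complex.I * (lam : ℂ)) *
    (Real.sqrt x : ℂ) * besselI (-(Complex.I * (lam : ℂ))) (μ * x)

/-- `g₂(x,μ) = (1/(2iλ))·Γ(1+iλ)·(μ/2)^{−iλ}·√x·I_{iλ}(μx)`. -/
noncomputable def g2 (lam : ℝ) (x : ℝ) (μ : ℂ) : ℂ :=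
  (1 / (2 * Complex.I * (lam : ℂ))) * Complex.Gamma (1 + Complex.I * lam) *
    (μ / 2) ^ (-(Complex.I * (lam : ℂ))) * (Real.sqrt x : ℂ) *
      besselI (Complex.I * (lam : ℂ)) (μ * x)

/-- The regularized confluent hypergeometric limit function `∑ k, w ^ k / (Γ(k + b) k!)`. -/
noncomputable def regHyp (b w : ℂ) : ℂ :=
  ∑' k : ℕ, w ^ k / (Complex.Gamma (k + b) * (Nat.factorial k : ℂ))

lemma summable_norm_regHyp (b w : ℂ) :
    Summable fun k : ℕ ↦ ‖w ^ k / (Complex.Gamma (k + b) * (Nat.factorial k : ℂ))‖ := by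
  have hr : (Complex.regularizedHGFunSeries 0 {b}).radius = ⊤ :=
    Complex.radius_regularizedHGFunSeries_eq_top (by simp)
  have h := (Complex.regularizedHGFunSeries 0 {b}).summable_norm_mul_pow (r := ‖w‖₊)
    (by rw [hr]; exact ENNReal.coe_lt_top)
  refine h.congr fun k ↦ ?_
  rw [FormalMultilinearSeries.norm_apply_eq_norm_coef, Complex.regularizedHGFunSeries_coeff]
  simp [Complex.regularizedHGFunCoeff, div_eq_mul_inv, add_comm]
  ring

lemma hasSum_regHyp (b w : ℂ) :
    HasSum (fun k : ℕ ↦ w ^ k / (Complex.Gamma (k + b) * (Nat.factorial k : ℂ))) (regHyp b w) :=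
  (summable_norm_regHyp b w).of_norm.hasSum

lemma succ_div_regHyp_coeff (b w : ℂ) (k : ℕ) :
    ((k + 1 : ℕ) : ℂ) * w ^ k / (Complex.Gamma ((k + 1 : ℕ) + b) * (Nat.factorial (k + 1) : ℂ)) =
      w ^ k / (Complex.Gamma (k + (b + 1)) * (Nat.factorial k : ℂ)) := by
  have h : ((k + 1 : ℕ) : ℂ) ≠ 0 := Nat.cast_ne_zero.2 k.succ_ne_zero
  rw [show ((k + 1 : ℕ) : ℂ) + b = k + (b + 1) by push_cast; ring, Nat.factorial_succ,
    Nat.cast_mul, mul_left_comm, mul_div_mul_left _ _ h]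

lemma hasDerivAt_regHyp (b w : ℂ) : HasDerivAt (regHyp b) (regHyp (b + 1) w) w := by
  set R : ℝ := ‖w‖ + 1
  have hR : 0 < R := by positivity
  let g' : ℕ → ℂ → ℂ := fun k y ↦
    (k : ℂ) * y ^ (k - 1) / (Complex.Gamma (k + b) * (Nat.factorial k : ℂ))
  have hsucc : ∀ k y, g' (k + 1) y =
      y ^ k / (Complex.Gamma (k + (b + 1)) * (Nat.factorial k : ℂ)) :=
    fun k y ↦ succ_div_regHyp_coeff b y k
  have hu : Summable fun k ↦ ‖g' k R‖ := by
    rw [← summable_nat_add_iff 1]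
    simpa only [hsucc] using summable_norm_regHyp (b + 1) R
  have hw : w ∈ Metric.ball (0 : ℂ) R := by simp [R]
  have key := hasDerivAt_tsum_of_isPreconnected (g' := g') hu Metric.isOpen_ball
    (convex_ball (0 : ℂ) R).isPreconnected
    (g := fun (k : ℕ) (y : ℂ) ↦ y ^ k / (Complex.Gamma (k + b) * (Nat.factorial k : ℂ)))
    (fun k y _ ↦ (hasDerivAt_pow k y).div_const _)
    (fun k y hy ↦ by
      have hy' : ‖y‖ ≤ R := by simpa using (Metric.mem_ball.1 hy).le
      simp only [g', norm_div, norm_mul, norm_pow, Complex.norm_real, Real.norm_eq_abs,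
        abs_of_pos hR]
      gcongr)
    hw (summable_norm_regHyp b w).of_norm hw
  refine HasDerivAt.congr_deriv key ?_
  rw [((summable_nat_add_iff 1).1 (by
    simpa only [hsucc] using (summable_norm_regHyp (b + 1) w).of_norm)).tsum_eq_zero_add]
  simp only [hsucc]
  simp [g', regHyp]

lemma regHyp_eq (b w : ℂ) :
    regHyp b w = b * regHyp (b + 1) w + w * regHyp (b + 2) w := by
  have h1 := (hasSum_regHyp (b + 1) w).mul_left b
  have h2 : HasSum (fun k : ℕ ↦ (k : ℂ) * w ^ k /
      (Complex.Gamma (k + (b + 1)) * (Nat.factorial k : ℂ))) (w * regHyp (b + 2) w) := by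
    have hsucc : ∀ k : ℕ, ((k + 1 : ℕ) : ℂ) * w ^ (k + 1) /
        (Complex.Gamma ((k + 1 : ℕ) + (b + 1)) * (Nat.factorial (k + 1) : ℂ)) =
        w * (w ^ k / (Complex.Gamma (k + (b + 2)) * (Nat.factorial k : ℂ))) := fun k ↦ by
      have := succ_div_regHyp_coeff (b + 1) w k
      rw [show b + 1 + 1 = b + 2 by ring] at this
      rw [← this, pow_succ]
      ring
    rw [← hasSum_nat_add_iff' 1]
    simpa only [hsucc, Finset.sum_range_one, Nat.cast_zero, zero_mul, zero_div, sub_zero] using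
      (hasSum_regHyp (b + 2) w).mul_left w
  have hcoeff : ∀ k : ℕ, w ^ k / (Complex.Gamma (k + b) * (Nat.factorial k : ℂ)) =
      b * (w ^ k / (Complex.Gamma (k + (b + 1)) * (Nat.factorial k : ℂ))) +
        k * w ^ k / (Complex.Gamma (k + (b + 1)) * (Nat.factorial k : ℂ)) := fun k ↦ by
    have hG := Complex.one_div_Gamma_eq_self_mul_one_div_Gamma_add_one (k + b)
    rw [add_assoc] at hG
    simp only [div_eq_mul_inv, mul_inv, hG]
    ring
  refine (hasSum_regHyp b w).unique ?_
  simpa only [hcoeff] using h1.add h2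

/-- Uniform exponential bound for solutions of `u'' = (a² - q / r²) u` on `[1, ∞)`, in terms of
the initial data at `1`. -/
lemma norm_sq_le_of_hasDerivAt {u u' : ℝ → ℂ} {a q : ℂ} (ha : ‖a‖ = 1) (ha' : 0 ≤ a.re)
    (hu : ∀ r : ℝ, 1 ≤ r → HasDerivAt u (u' r) r)
    (hu' : ∀ r : ℝ, 1 ≤ r → HasDerivAt u' ((a ^ 2 - q / r ^ 2) * u r) r) {r : ℝ} (hr : 1 ≤ r) :
    ‖Complex.exp (-(a * r)) * u r‖ ^ 2 ≤ Real.exp (2 * ‖q‖) * (‖u' 1‖ ^ 2 + ‖u 1‖ ^ 2) := by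
  set e : ℝ → ℂ := fun s ↦ Complex.exp (-(a * s)) with he
  have hde : ∀ s : ℝ, HasDerivAt e (-a * e s) s := fun s ↦ by
    have h : HasDerivAt (fun s : ℝ ↦ -(a * (s : ℂ))) (-(a * 1)) s :=
      ((Complex.ofRealCLM.hasDerivAt (x := s)).const_mul a).neg
    refine h.cexp.congr_deriv ?_
    simp only [he]; ring
  set y : ℝ → ℂ := fun s ↦ e s * (u' s + a * u s) with hy
  set z : ℝ → ℂ := fun s ↦ e s * (u' s - a * u s) with hz
  have hdy : ∀ s : ℝ, 1 ≤ s → HasDerivAt y (-(q / s ^ 2 * (e s * u s))) s := fun s hs ↦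
    ((hde s).mul ((hu' s hs).add ((hu s hs).const_mul a))).congr_deriv
      (by simp only [Pi.add_apply]; ring)
  have hdz : ∀ s : ℝ, 1 ≤ s → HasDerivAt z (-(2 * a * z s) - q / s ^ 2 * (e s * u s)) s :=
    fun s hs ↦ ((hde s).mul ((hu' s hs).sub ((hu s hs).const_mul a))).congr_deriv
      (by simp only [hz, Pi.sub_apply]; ring)
  have hw : ∀ s, 2 * ‖e s * u s‖ ≤ ‖y s‖ + ‖z s‖ := fun s ↦ by
    have h : y s - z s = 2 * a * (e s * u s) := by simp only [hy, hz]; ring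
    have h2 := norm_sub_le (y s) (z s)
    rw [h] at h2
    simpa [ha] using h2
  set E : ℝ → ℝ := fun s ↦ ‖y s‖ ^ 2 + ‖z s‖ ^ 2 with hE
  have hinner : ∀ s, inner ℝ (z s) (-(2 * a * z s)) ≤ 0 := fun s ↦ by
    have h : inner ℝ (z s) (-(2 * a * z s)) = -(2 * a.re * (‖z s‖ ^ 2)) := by
      rw [Complex.inner, ← Complex.normSq_eq_norm_sq, Complex.normSq_apply]
      simp
      ring
    rw [h]
    have : 0 ≤ 2 * a.re * ‖z s‖ ^ 2 := by positivity
    linarith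
  set E' : ℝ → ℝ := fun s ↦ 2 * inner ℝ (y s) (-(q / s ^ 2 * (e s * u s))) +
    2 * inner ℝ (z s) (-(2 * a * z s) - q / s ^ 2 * (e s * u s)) with hE'
  have hdE : ∀ s : ℝ, 1 ≤ s → HasDerivAt E (E' s) s := fun s hs ↦
    (hdy s hs).norm_sq.add (hdz s hs).norm_sq
  have hE'le : ∀ s : ℝ, 1 ≤ s → E' s ≤ 2 * ‖q‖ / s ^ 2 * E s := fun s hs ↦ by
    have h1 := real_inner_le_norm (y s) (-(q / s ^ 2 * (e s * u s)))
    have h2 := real_inner_le_norm (z s) (-(q / s ^ 2 * (e s * u s)))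
    have hn : ‖-(q / (s : ℂ) ^ 2 * (e s * u s))‖ = ‖q‖ / s ^ 2 * ‖e s * u s‖ := by
      rw [norm_neg, norm_mul, norm_div, norm_pow, Complex.norm_real, Real.norm_eq_abs, sq_abs]
    rw [hn] at h1 h2
    have h3 := hinner s
    have hc : 0 ≤ ‖q‖ / s ^ 2 := by positivity
    simp only [hE', hE, sub_eq_add_neg, inner_add_right]
    calc _ ≤ ‖q‖ / s ^ 2 * ((2 * ‖e s * u s‖) * (‖y s‖ + ‖z s‖)) := by linarith
      _ ≤ ‖q‖ / s ^ 2 * ((‖y s‖ + ‖z s‖) * (‖y s‖ + ‖z s‖)) := by gcongr; exact hw s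
      _ ≤ ‖q‖ / s ^ 2 * (2 * (‖y s‖ ^ 2 + ‖z s‖ ^ 2)) := by
        refine mul_le_mul_of_nonneg_left ?_ hc
        nlinarith [sq_nonneg (‖y s‖ - ‖z s‖)]
      _ = _ := by ring
  have hdexp : ∀ s : ℝ, 1 ≤ s → HasDerivAt (fun s ↦ Real.exp (2 * ‖q‖ * s⁻¹))
      (Real.exp (2 * ‖q‖ * s⁻¹) * (2 * ‖q‖ * -(s ^ 2)⁻¹)) s := fun s hs ↦
    ((hasDerivAt_inv (by positivity)).const_mul (2 * ‖q‖)).exp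
  have hanti : AntitoneOn (fun s ↦ E s * Real.exp (2 * ‖q‖ * s⁻¹)) (Set.Ici 1) := by
    have hd := fun s (hs : 1 ≤ s) ↦ (hdE s hs).mul (hdexp s hs)
    refine antitoneOn_of_hasDerivWithinAt_nonpos (convex_Ici 1)
      (fun s hs ↦ (hd s hs).continuousAt.continuousWithinAt)
      (fun s hs ↦ (hd s (interior_subset hs)).hasDerivWithinAt) fun s hs ↦ ?_
    have h := hE'le s (interior_subset hs)
    have hp := Real.exp_pos (2 * ‖q‖ * s⁻¹)
    have : E' s * Real.exp (2 * ‖q‖ * s⁻¹) ≤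
      2 * ‖q‖ / s ^ 2 * E s * Real.exp (2 * ‖q‖ * s⁻¹) := by gcongr
    calc _ ≤ 2 * ‖q‖ / s ^ 2 * E s * Real.exp (2 * ‖q‖ * s⁻¹) +
          E s * (Real.exp (2 * ‖q‖ * s⁻¹) * (2 * ‖q‖ * -(s ^ 2)⁻¹)) := by gcongr
      _ = 0 := by ring
  have hEr : E r ≤ E 1 * Real.exp (2 * ‖q‖) := by
    have h := hanti (Set.mem_Ici.2 le_rfl) (Set.mem_Ici.2 hr) hr
    simp only [inv_one, mul_one] at h
    refine le_trans (le_mul_of_one_le_right (by positivity) ?_) h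
    exact Real.one_le_exp (by positivity)
  have hE1 : E 1 ≤ 2 * (‖u' 1‖ ^ 2 + ‖u 1‖ ^ 2) := by
    have hp := parallelogram_law_with_norm ℝ (u' 1) (a * u 1)
    rw [norm_mul, ha, one_mul] at hp
    have he1 : ‖e 1‖ ≤ 1 := by simp [he, Complex.norm_exp, ha']
    have he2 : ‖e 1‖ ^ 2 ≤ 1 := pow_le_one₀ (norm_nonneg _) he1
    simp only [hE, hy, hz, norm_mul, mul_pow]
    calc _ = ‖e 1‖ ^ 2 * (2 * (‖u' 1‖ ^ 2 + ‖u 1‖ ^ 2)) := by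
          linear_combination ‖e 1‖ ^ 2 * hp
      _ ≤ _ := mul_le_of_le_one_left (by positivity) he2
  have hwr : 2 * ‖e r * u r‖ ^ 2 ≤ E r := by
    have h := hw r
    have h0 := norm_nonneg (e r * u r)
    simp only [hE]
    nlinarith [sq_nonneg (‖y r‖ - ‖z r‖)]
  have := mul_le_mul_of_nonneg_right hE1 (Real.exp_pos (2 * ‖q‖)).le
  change ‖e r * u r‖ ^ 2 ≤ _
  linarith

lemma continuous_regHyp (b : ℂ) : Continuous (regHyp b) :=
  continuous_iff_continuousAt.2 fun w ↦ (hasDerivAt_regHyp b w).continuousAt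

lemma exists_norm_regHyp_le (b : ℂ) : ∃ M, 0 < M ∧ ∀ w : ℂ, ‖w‖ ≤ 1 → ‖regHyp b w‖ ≤ M := by
  obtain ⟨M, hM⟩ := (isCompact_closedBall (0 : ℂ) 1).exists_bound_of_continuousOn
    (continuous_regHyp b).continuousOn
  exact ⟨max M 1, by positivity, fun w hw ↦ (hM w (by simpa using hw)).trans (le_max_left _ _)⟩

lemma hasDerivAt_regHyp_ray (b a : ℂ) (r : ℝ) :
    HasDerivAt (fun s : ℝ ↦ regHyp b (a ^ 2 * s ^ 2 / 4))
      (a ^ 2 * r / 2 * regHyp (b + 1) (a ^ 2 * r ^ 2 / 4)) r := by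
  have h : HasDerivAt (fun s : ℂ ↦ a ^ 2 * s ^ 2 / 4) (a ^ 2 * r / 2) (r : ℂ) :=
    (((hasDerivAt_pow 2 (r : ℂ)).const_mul (a ^ 2)).div_const 4).congr_deriv
      (by push_cast; ring)
  exact ((hasDerivAt_regHyp b _).comp (r : ℂ) h).comp_ofReal.congr_deriv (by ring)

lemma exists_sqrt_mul_norm_regHyp_le_of_one_le {ν : ℂ} (hν : ν.re = 0) :
    ∃ C, 0 < C ∧ ∀ (a : ℂ) (r : ℝ), ‖a‖ = 1 → 0 ≤ a.re → 1 ≤ r →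
      √r * ‖regHyp (ν + 1) (a ^ 2 * r ^ 2 / 4)‖ ≤ C * Real.exp (a.re * r) := by
  obtain ⟨M, hM0, hM⟩ := exists_norm_regHyp_le (ν + 1)
  obtain ⟨N, hN0, hN⟩ := exists_norm_regHyp_le (ν + 2)
  set m : ℂ := ν + 1 / 2 with hm
  have hmre : m.re = 1 / 2 := by simp [hm, hν]
  have hm0 : m ≠ 0 := fun h ↦ by norm_num [h] at hmre
  set q : ℂ := 1 / 4 - ν ^ 2 with hq
  set K : ℝ := Real.exp (2 * ‖q‖) * ((‖m‖ * M + N) ^ 2 + M ^ 2) with hK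
  have hK0 : 0 < K := by positivity
  refine ⟨√K, Real.sqrt_pos.2 hK0, fun a r ha ha' hr ↦ ?_⟩
  set f : ℝ → ℂ := fun s ↦ regHyp (ν + 1) (a ^ 2 * s ^ 2 / 4) with hf
  set g : ℝ → ℂ := fun s ↦ regHyp (ν + 2) (a ^ 2 * s ^ 2 / 4) with hg
  have hdf : ∀ s, HasDerivAt f (a ^ 2 * s / 2 * g s) s := fun s ↦
    (hasDerivAt_regHyp_ray (ν + 1) a s).congr_deriv
      (by simp only [hg, show ν + 1 + 1 = ν + 2 by ring])
  have hdg : ∀ s : ℝ, 1 ≤ s → HasDerivAt g (2 / s * (f s - (ν + 1) * g s)) s := fun s hs ↦ by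
    have hs0 : (s : ℂ) ≠ 0 := by exact_mod_cast (by linarith : s ≠ 0)
    refine (hasDerivAt_regHyp_ray (ν + 2) a s).congr_deriv ?_
    simp only [hf, hg]
    rw [regHyp_eq (ν + 1), show ν + 1 + 1 = ν + 2 by ring, show ν + 1 + 2 = ν + 2 + 1 by ring]
    field_simp
    ring
  have hdp : ∀ s : ℝ, 1 ≤ s → HasDerivAt (fun s : ℝ ↦ (s : ℂ) ^ m) (m / s * (s : ℂ) ^ m) s :=
    fun s hs ↦ by
      have hs0 : s ≠ 0 := by linarith
      have hs0' : (s : ℂ) ≠ 0 := by exact_mod_cast hs0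
      refine (hasDerivAt_ofReal_cpow_const hs0 hm0).congr_deriv ?_
      rw [Complex.cpow_sub _ _ hs0', Complex.cpow_one]
      ring
  have hdinv : ∀ s : ℝ, 1 ≤ s → HasDerivAt (fun s : ℝ ↦ m / (s : ℂ)) (-m / s ^ 2) s :=
    fun s hs ↦ by
      have hs0' : (s : ℂ) ≠ 0 := by exact_mod_cast (by linarith : s ≠ 0)
      exact (((hasDerivAt_inv hs0').const_mul m).comp_ofReal).congr_deriv (by ring)
  have hdid : ∀ s : ℝ, HasDerivAt (fun s : ℝ ↦ a ^ 2 * (s : ℂ) / 2) (a ^ 2 / 2) s := fun s ↦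
    (((hasDerivAt_id (s : ℂ)).const_mul (a ^ 2)).div_const 2).comp_ofReal.congr_deriv (by ring)
  have key := norm_sq_le_of_hasDerivAt (u := fun s ↦ (s : ℂ) ^ m * f s)
    (u' := fun s ↦ (s : ℂ) ^ m * (m / s * f s + a ^ 2 * s / 2 * g s)) (q := q) ha ha'
    (fun s hs ↦ ((hdp s hs).mul (hdf s)).congr_deriv (by ring))
    (fun s hs ↦ by
      have hs0' : (s : ℂ) ≠ 0 := by exact_mod_cast (by linarith : s ≠ 0)
      refine ((hdp s hs).mul (((hdinv s hs).mul (hdf s)).add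
        ((hdid s).mul (hdg s hs)))).congr_deriv ?_
      simp only [hm, hq, Pi.add_apply, Pi.mul_apply]
      field_simp
      ring) hr
  have hrp : ‖(r : ℂ) ^ m‖ = √r := by
    rw [Complex.norm_cpow_eq_rpow_re_of_pos (by linarith), hmre, Real.sqrt_eq_rpow]
  have hball : ‖a ^ 2 * ((1 : ℝ) : ℂ) ^ 2 / 4‖ ≤ 1 := by simp [ha]; norm_num
  have hf1 : ‖f 1‖ ≤ M := hM _ hball
  have hg1 : ‖g 1‖ ≤ N := hN _ hball
  have h1 : ‖m / ((1 : ℝ) : ℂ) * f 1 + a ^ 2 * ((1 : ℝ) : ℂ) / 2 * g 1‖ ≤ ‖m‖ * M + N := by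
    refine (norm_add_le _ _).trans ?_
    simp only [Complex.ofReal_one, div_one, mul_one, norm_mul, norm_div, norm_pow, ha, one_pow,
      Complex.norm_ofNat]
    have := norm_nonneg (g 1)
    gcongr
    linarith
  have hle : Real.exp (2 * ‖q‖) *
      (‖(((1 : ℝ) : ℂ)) ^ m * (m / ((1 : ℝ) : ℂ) * f 1 + a ^ 2 * ((1 : ℝ) : ℂ) / 2 * g 1)‖ ^ 2 +
        ‖(((1 : ℝ) : ℂ)) ^ m * f 1‖ ^ 2) ≤ K := by
    rw [norm_mul _ (f 1), norm_mul, Complex.ofReal_one, Complex.one_cpow, norm_one, one_mul,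
      one_mul, hK]
    rw [Complex.ofReal_one] at h1
    gcongr
  have h2 := Real.le_sqrt_of_sq_le (key.trans hle)
  rw [norm_mul, norm_mul, hrp, Complex.norm_exp] at h2
  have hre : (-(a * (r : ℂ))).re = -(a.re * r) := by simp
  rw [hre] at h2
  calc _ = Real.exp (-(a.re * r)) * (√r * ‖f r‖) * Real.exp (a.re * r) := by
        rw [mul_comm (Real.exp _), mul_assoc, ← Real.exp_add]; simp [hf]
    _ ≤ _ := by gcongr

lemma exists_sqrt_mul_norm_regHyp_le {ν : ℂ} (hν : ν.re = 0) :
    ∃ C, 0 < C ∧ ∀ z : ℂ, 0 ≤ z.re →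
      √(1 + ‖z‖) * ‖regHyp (ν + 1) (z ^ 2 / 4)‖ ≤ C * Real.exp z.re := by
  obtain ⟨M, hM0, hM⟩ := exists_norm_regHyp_le (ν + 1)
  obtain ⟨C, hC0, hC⟩ := exists_sqrt_mul_norm_regHyp_le_of_one_le hν
  refine ⟨√2 * max M C, by positivity, fun z hz ↦ ?_⟩
  rcases le_total ‖z‖ 1 with h | h
  · have h1 : ‖z ^ 2 / 4‖ ≤ 1 := by
      rw [norm_div, norm_pow, Complex.norm_ofNat]
      nlinarith [norm_nonneg z]
    have h2 : 1 ≤ Real.exp z.re := Real.one_le_exp hz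
    calc _ ≤ √2 * max M C := by
          gcongr
          · linarith
          · exact (hM _ h1).trans (le_max_left _ _)
      _ ≤ _ := le_mul_of_one_le_right (by positivity) h2
  · have hz0 : (‖z‖ : ℂ) ≠ 0 := by exact_mod_cast (by linarith : ‖z‖ ≠ 0)
    have hz0' : ‖z‖ ≠ 0 := by linarith
    have key := hC (z / ‖z‖) ‖z‖ (by simp [hz0'])
      (by rw [Complex.div_ofReal_re]; positivity) h
    rw [Complex.div_ofReal_re, div_mul_cancel₀ _ hz0', ← mul_pow, div_mul_cancel₀ _ hz0] at key
    calc _ ≤ √(2 * ‖z‖) * ‖regHyp (ν + 1) (z ^ 2 / 4)‖ := by gcongr; linarith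
      _ = √2 * (√‖z‖ * ‖regHyp (ν + 1) (z ^ 2 / 4)‖) := by
        rw [Real.sqrt_mul (by norm_num)]; ring
      _ ≤ √2 * (C * Real.exp z.re) := by gcongr
      _ ≤ √2 * (max M C * Real.exp z.re) := by gcongr; exact le_max_right _ _
      _ = _ := by ring

lemma besselI_eq_cpow_mul_regHyp (ν : ℂ) {z : ℂ} (hz : z ≠ 0) :
    besselI ν z = (z / 2) ^ ν * regHyp (ν + 1) (z ^ 2 / 4) := by
  rw [besselI, regHyp, ← tsum_mul_left]
  refine tsum_congr fun k ↦ ?_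
  have h : (2 * (k : ℂ)) = ((2 * k : ℕ) : ℂ) := by push_cast; ring
  rw [Complex.cpow_add _ _ (by simpa using hz), h, Complex.cpow_natCast, pow_mul, div_pow,
    ← add_assoc]
  norm_num
  ring

lemma norm_cpow_le_of_re_eq_zero {z s : ℂ} (hz : z ≠ 0) (hs : s.re = 0) :
    ‖z ^ s‖ ≤ Real.exp (Real.pi * ‖s‖) := by
  rw [Complex.norm_cpow_of_ne_zero hz, hs, Real.rpow_zero, one_div, ← Real.exp_neg]
  refine Real.exp_le_exp.2 ((neg_le_abs _).trans ?_)
  rw [abs_mul]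
  gcongr
  · exact Complex.abs_arg_le_pi z
  · exact Complex.abs_im_le_norm s

lemma exists_norm_besselI_le {ν : ℂ} (hν : ν.re = 0) (c : ℂ) :
    ∃ C, 0 < C ∧ ∀ x : ℝ, 0 < x → ∀ μ : ℂ, 0 ≤ μ.re → μ ≠ 0 →
      ‖c * (μ / 2) ^ (-ν) * (√x : ℂ) * besselI ν (μ * x)‖ ≤
        C * √(x / (1 + ‖μ‖ * x)) * Real.exp (μ.re * x) := by
  obtain ⟨C, hC0, hC⟩ := exists_sqrt_mul_norm_regHyp_le hν
  set A := Real.exp (Real.pi * ‖ν‖)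
  refine ⟨(‖c‖ + 1) * A * A * C, by positivity, fun x hx μ hμ hμ0 ↦ ?_⟩
  have hz : μ * x ≠ 0 := mul_ne_zero hμ0 (by exact_mod_cast hx.ne')
  have hre : (μ * x).re = μ.re * x := by simp
  have hn : ‖μ * x‖ = ‖μ‖ * x := by simp [abs_of_pos hx]
  have key := hC (μ * x) (by rw [hre]; positivity)
  rw [hre, hn] at key
  have h1 : ‖(μ / 2) ^ (-ν)‖ ≤ A := by
    simpa using norm_cpow_le_of_re_eq_zero (z := μ / 2) (s := -ν) (by simpa using hμ0) (by simpa)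
  have h2 : ‖(μ * x / 2) ^ ν‖ ≤ A := norm_cpow_le_of_re_eq_zero (by simpa using hz) hν
  have hpos : 0 < √(1 + ‖μ‖ * x) := by positivity
  have h3 : ‖regHyp (ν + 1) ((μ * x) ^ 2 / 4)‖ ≤
      C * Real.exp (μ.re * x) / √(1 + ‖μ‖ * x) := by
    rw [le_div_iff₀ hpos]; linarith
  rw [besselI_eq_cpow_mul_regHyp ν hz]
  simp only [norm_mul]
  rw [Complex.norm_real, Real.norm_of_nonneg (Real.sqrt_nonneg x), Real.sqrt_div hx.le]
  calc _ ≤ (‖c‖ + 1) * A * √x * (A * (C * Real.exp (μ.re * x) / √(1 + ‖μ‖ * x))) := by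
        gcongr; linarith
    _ = _ := by ring

/-- Estimate on the unperturbed Bessel solutions `g₁, g₂`: for `λ ≠ 0` there is
`C > 0` with `|g_j(x,μ)| ≤ C (x/(1+|μ|x))^{1/2} e^{Re(μ)x}` for all `x > 0` and
all `μ` with `Re μ ≥ 0`, `μ ≠ 0`. -/
theorem stmt3 (lam : ℝ) (hlam : lam ≠ 0) :
    ∃ C : ℝ, 0 < C ∧ ∀ x : ℝ, 0 < x → ∀ μ : ℂ, 0 ≤ μ.re → μ ≠ 0 →
      ‖g1 lam x μ‖ ≤ C * Real.sqrt (x / (1 + ‖μ‖ * x)) * Real.exp (μ.re * x) ∧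
      ‖g2 lam x μ‖ ≤ C * Real.sqrt (x / (1 + ‖μ‖ * x)) * Real.exp (μ.re * x) := by
  have hre : (Complex.I * (lam : ℂ)).re = 0 := by simp
  obtain ⟨C₁, hC₁, h₁⟩ := exists_norm_besselI_le (ν := -(Complex.I * (lam : ℂ))) (by simp)
    (Complex.Gamma (1 - Complex.I * lam))
  obtain ⟨C₂, hC₂, h₂⟩ := exists_norm_besselI_le hre
    (1 / (2 * Complex.I * (lam : ℂ)) * Complex.Gamma (1 + Complex.I * lam))
  rw [neg_neg] at h₁
  refine ⟨max C₁ C₂, by positivity, fun x hx μ hμ hμ0 ↦ ⟨?_, ?_⟩⟩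
  · refine (h₁ x hx μ hμ hμ0).trans ?_
    gcongr
    exact le_max_left _ _
  · refine (h₂ x hx μ hμ hμ0).trans ?_
    gcongr
    exact le_max_right _ _
end

section
/- Let A > 0, x₀ ∈ (0,A), ε > 0, C₀ > 0, and let q₀ : (0,A) → ℂ be a measurable function satisfying |q₀(t)| ≤ C₀ · t^{−2} · (1+|log t|)^{−1−ε} for all t ∈ (0,x₀), and ∫₀^A t·|q₀(t)| dt < ∞. Then there exist r₀ > 1 and C > 0 such that for every real r ≥ r₀ and every x ∈ (0,A) with x ≥ r^{−1/2}, one has ∫₀^x t·|q₀(t)|/(1+r·t) dt ≤ C · (log r)^{−ε}. -/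
open MeasureTheory

/-- The function `t ↦ (1 - log t)^{-ε} / ε`, set to its limit `0` at `t = 0`, is continuous on
`[0, s]` for `s < 1`. -/
theorem continuousOn_update_one_sub_log_rpow {ε s : ℝ} (hε : 0 < ε) (hs : s < 1) :
    ContinuousOn (Function.update (fun t : ℝ => (1 - Real.log t) ^ (-ε) / ε) 0 0)
      (Set.Icc 0 s) := by
  intro t ht
  rcases eq_or_lt_of_le ht.1 with rfl | h0
  · rw [continuousWithinAt_update_same]
    have h1 : Filter.Tendsto (fun t : ℝ => 1 - Real.log t) (nhdsWithin 0 (Set.Ioi 0))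
        Filter.atTop :=
      Filter.tendsto_atTop_add_const_left _ 1
        (Filter.tendsto_neg_atBot_atTop.comp Real.tendsto_log_nhdsGT_zero)
    have h2 := ((tendsto_rpow_neg_atTop hε).comp h1).div_const ε
    rw [zero_div] at h2
    exact h2.mono_left (nhdsWithin_mono _ fun u hu => lt_of_le_of_ne hu.1.1 (Ne.symm hu.2))
  · have hlog : Real.log t < 0 := Real.log_neg h0 (ht.2.trans_lt hs)
    rw [continuousWithinAt_update_of_ne h0.ne']
    have h : ContinuousAt (fun t : ℝ => (1 - Real.log t) ^ (-ε) / ε) t :=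
      ((continuousAt_const.sub (Real.continuousAt_log h0.ne')).rpow_const
        (Or.inl (sub_pos.mpr (hlog.trans one_pos)).ne')).div_const ε
    exact h.continuousWithinAt

theorem hasDerivAt_one_sub_log_rpow {ε t : ℝ} (hε : 0 < ε) (ht : 0 < t) (ht1 : t < 1) :
    HasDerivAt (fun t : ℝ => (1 - Real.log t) ^ (-ε) / ε)
      (t⁻¹ * (1 - Real.log t) ^ (-1 - ε)) t := by
  have hlog : Real.log t < 0 := Real.log_neg ht ht1
  have h := (((Real.hasDerivAt_log ht.ne').const_sub 1).rpow_const (p := -ε)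
    (Or.inl (by linarith))).div_const ε
  refine h.congr_deriv ?_
  rw [show -ε - 1 = -1 - ε by ring]
  field_simp

/-- Contribution of a neighbourhood of `0` to the integral of a function dominated by
`C₀ t⁻¹ (1 - log t)^{-1-ε}`. -/
theorem setIntegral_Ioo_le_of_le_inv_mul_log_rpow {ε C₀ s : ℝ} (hε : 0 < ε) (hs0 : 0 < s)
    (hs : s < 1) {f : ℝ → ℝ} (hf : IntegrableOn f (Set.Ioo 0 s))
    (hle : ∀ t ∈ Set.Ioo 0 s, f t ≤ C₀ * (t⁻¹ * (1 - Real.log t) ^ (-1 - ε))) :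
    ∫ t in Set.Ioo 0 s, f t ≤ C₀ * ((1 - Real.log s) ^ (-ε) / ε) := by
  have key := intervalIntegral.integral_le_sub_of_hasDeriv_right_of_le (φ := f) hs0.le
    ((continuousOn_update_one_sub_log_rpow hε hs).const_mul C₀)
    (fun t ht => by
      have hd := (hasDerivAt_one_sub_log_rpow hε ht.1 (ht.2.trans hs)).const_mul C₀
      refine (hd.congr_of_eventuallyEq ?_).hasDerivWithinAt
      filter_upwards [isOpen_ne.mem_nhds ht.1.ne'] with u hu
      rw [Function.update_of_ne hu])
    (by rwa [integrableOn_Icc_iff_integrableOn_Ioo]) hle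
  rw [Function.update_self, Function.update_of_ne hs0.ne', mul_zero, sub_zero,
    intervalIntegral.integral_of_le hs0.le, integral_Ioc_eq_integral_Ioo] at key
  exact key

/-- `r^{-1/2}` decays faster than any power of `log r`. -/
theorem rpow_neg_half_le_log_rpow {ε r : ℝ} (hε : 0 < ε) (hr : 1 < r) :
    r ^ (-(1/2) : ℝ) ≤ (2 * ε) ^ ε * Real.log r ^ (-ε) := by
  have hr0 : 0 < r := by linarith
  have hlog : 0 < Real.log r := Real.log_pos hr
  have h1 : Real.log r ≤ 2 * ε * r ^ (1 / (2 * ε)) := by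
    have := Real.log_le_rpow_div hr0.le (show 0 < 1 / (2 * ε) by positivity)
    rwa [div_div_eq_mul_div, div_one, mul_comm] at this
  have h2 := Real.rpow_le_rpow hlog.le h1 hε.le
  rw [Real.mul_rpow (by positivity) (by positivity), ← Real.rpow_mul hr0.le,
    show 1 / (2 * ε) * ε = 1 / 2 by field_simp] at h2
  rw [Real.rpow_neg hr0.le, Real.rpow_neg hlog.le, ← div_eq_mul_inv, inv_eq_one_div,
    div_le_div_iff₀ (by positivity) (by positivity), one_mul]
  exact h2

/-- Key integral estimate for large angular momentum: if
`|q₀(t)| ≤ C₀ t⁻²(1+|log t|)^{−1−ε}` near `0` and `∫₀^A t|q₀(t)| dt < ∞`, then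
there are `r₀ > 1` and `C > 0` such that for all `r ≥ r₀` and `x ∈ (0,A)` with
`x ≥ r^{−1/2}`, `∫₀^x t|q₀(t)|/(1+rt) dt ≤ C (log r)^{−ε}`. -/
theorem stmt4 (A x₀ ε C₀ : ℝ) (hA : 0 < A) (hx₀ : x₀ ∈ Set.Ioo 0 A)
    (hε : 0 < ε) (hC₀ : 0 < C₀)
    (q₀ : ℝ → ℂ) (hmeas : Measurable q₀)
    (hbound : ∀ t ∈ Set.Ioo (0 : ℝ) x₀,
      ‖q₀ t‖ ≤ C₀ * t ^ (-2 : ℝ) * (1 + |Real.log t|) ^ (-1 - ε))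
    (hint : IntegrableOn (fun t : ℝ => t * ‖q₀ t‖) (Set.Ioo 0 A)) :
    ∃ r₀ : ℝ, 1 < r₀ ∧ ∃ C : ℝ, 0 < C ∧
      ∀ r : ℝ, r₀ ≤ r → ∀ x ∈ Set.Ioo (0 : ℝ) A, r ^ (-(1/2) : ℝ) ≤ x →
        (∫ t in Set.Ioo (0 : ℝ) x, t * ‖q₀ t‖ / (1 + r * t)) ≤
          C * Real.log r ^ (-ε) := by
  obtain ⟨r₀, hr₀⟩ : ∃ r₀ : ℝ, ∀ r ≥ r₀, r ^ (-(1/2) : ℝ) < x₀ :=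
    Filter.eventually_atTop.mp
      ((tendsto_rpow_neg_atTop one_half_pos).eventually_lt_const hx₀.1)
  set M := ∫ t in Set.Ioo 0 A, t * ‖q₀ t‖
  have hM0 : 0 ≤ M := setIntegral_nonneg measurableSet_Ioo fun t ht =>
    mul_nonneg ht.1.le (norm_nonneg _)
  refine ⟨max r₀ 2, lt_max_of_lt_right one_lt_two,
    C₀ * (2 ^ ε / ε) + M * (2 * ε) ^ ε, by positivity, fun r hr x hx hrx => ?_⟩
  have hr1 : 1 < r := by linarith [le_max_right r₀ 2]
  have hr0 : 0 < r := by linarith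
  have hlogr : 0 < Real.log r := Real.log_pos hr1
  set s := r ^ (-(1/2) : ℝ) with hs
  have hsx₀ : s < x₀ := hr₀ r ((le_max_left _ _).trans hr)
  have hs0 : 0 < s := Real.rpow_pos_of_pos hr0 _
  have hs1 : s < 1 := Real.rpow_lt_one_of_one_lt_of_neg hr1 (by norm_num)
  have hrs : r * s * s = 1 := by
    rw [hs, mul_assoc, ← Real.rpow_add hr0, show -(1/2) + -(1/2) = (-1 : ℝ) by norm_num,
      Real.rpow_neg_one, mul_inv_cancel₀ hr0.ne']
  have hlogs : Real.log s = -(Real.log r / 2) := by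
    rw [hs, Real.log_rpow hr0]; ring
  have hden : ∀ t, 0 < t → 1 ≤ 1 + r * t := fun t ht => by nlinarith
  have hsub : Set.Ioo 0 x ⊆ Set.Ioo 0 A := Set.Ioo_subset_Ioo_right hx.2.le
  have hquot : IntegrableOn (fun t => t * ‖q₀ t‖ / (1 + r * t)) (Set.Ioo 0 x) := by
    refine (hint.mono_set hsub).mono'
      (show Measurable fun t => t * ‖q₀ t‖ / (1 + r * t) by fun_prop).aestronglyMeasurable ?_
    filter_upwards [ae_restrict_mem measurableSet_Ioo] with t ht
    have h0 : 0 ≤ t * ‖q₀ t‖ := mul_nonneg ht.1.le (norm_nonneg _)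
    have h1 := hden t ht.1
    rw [Real.norm_of_nonneg (by positivity)]
    exact div_le_self h0 h1
  have hsub₁ : Set.Ioo 0 s ⊆ Set.Ioo 0 x := Set.Ioo_subset_Ioo_right hrx
  have hsub₂ : Set.Ico s x ⊆ Set.Ioo 0 x := fun t ht => ⟨hs0.trans_le ht.1, ht.2⟩
  have hnear : ∫ t in Set.Ioo 0 s, t * ‖q₀ t‖ / (1 + r * t) ≤
      C₀ * (2 ^ ε / ε) * Real.log r ^ (-ε) := by
    refine (setIntegral_Ioo_le_of_le_inv_mul_log_rpow hε hs0 hs1 (C₀ := C₀)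
      (hquot.mono_set hsub₁) fun t ht => ?_).trans ?_
    · have h0 : 0 ≤ t * ‖q₀ t‖ := mul_nonneg ht.1.le (norm_nonneg _)
      refine (div_le_self h0 (hden t ht.1)).trans ?_
      have hb := mul_le_mul_of_nonneg_left (hbound t ⟨ht.1, ht.2.trans hsx₀⟩) ht.1.le
      rw [abs_of_neg (Real.log_neg ht.1 (ht.2.trans hs1)), ← sub_eq_add_neg,
        Real.rpow_neg ht.1.le, Real.rpow_two] at hb
      refine hb.trans_eq ?_
      have := ht.1.ne'
      field_simp
    · have h : (1 - Real.log s) ^ (-ε) ≤ 2 ^ ε * Real.log r ^ (-ε) := by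
        calc (1 - Real.log s) ^ (-ε) ≤ (Real.log r / 2) ^ (-ε) :=
              Real.rpow_le_rpow_of_nonpos (by positivity) (by linarith) (by linarith)
          _ = 2 ^ ε * Real.log r ^ (-ε) := by
              rw [Real.div_rpow hlogr.le zero_le_two, Real.rpow_neg zero_le_two, div_inv_eq_mul,
                mul_comm]
      calc C₀ * ((1 - Real.log s) ^ (-ε) / ε) ≤ C₀ * (2 ^ ε * Real.log r ^ (-ε) / ε) := by
            gcongr
        _ = _ := by ring
  have hfar : ∫ t in Set.Ico s x, t * ‖q₀ t‖ / (1 + r * t) ≤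
      M * (2 * ε) ^ ε * Real.log r ^ (-ε) := by
    calc ∫ t in Set.Ico s x, t * ‖q₀ t‖ / (1 + r * t)
        ≤ ∫ t in Set.Ico s x, s * (t * ‖q₀ t‖) := by
          refine setIntegral_mono_on (hquot.mono_set hsub₂)
            ((hint.mono_set (hsub₂.trans hsub)).const_mul s) measurableSet_Ico fun t ht => ?_
          have ht0 : 0 < t := hs0.trans_le ht.1
          have h0 : 0 ≤ t * ‖q₀ t‖ := mul_nonneg ht0.le (norm_nonneg _)
          rw [div_le_iff₀ (by linarith [hden t ht0])]
          have h1 : 1 ≤ s * (1 + r * t) := by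
            nlinarith [mul_le_mul_of_nonneg_left ht.1 (mul_pos hr0 hs0).le]
          nlinarith
      _ = s * ∫ t in Set.Ico s x, t * ‖q₀ t‖ := integral_const_mul _ _
      _ ≤ s * M := by
          refine mul_le_mul_of_nonneg_left (setIntegral_mono_set hint ?_
            (hsub₂.trans hsub).eventuallyLE) hs0.le
          filter_upwards [ae_restrict_mem measurableSet_Ioo] with t ht
          exact mul_nonneg ht.1.le (norm_nonneg _)
      _ ≤ (2 * ε) ^ ε * Real.log r ^ (-ε) * M :=
          mul_le_mul_of_nonneg_right (rpow_neg_half_le_log_rpow hε hr1) hM0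
      _ = _ := by ring
  have hdisj : Disjoint (Set.Ioo 0 s) (Set.Ico s x) :=
    Set.disjoint_left.mpr fun t h1 h2 => absurd h1.2 h2.1.not_gt
  rw [← Set.Ioo_union_Ico_eq_Ioo hs0 hrx, setIntegral_union hdisj measurableSet_Ico
    (hquot.mono_set hsub₁) (hquot.mono_set hsub₂), add_mul]
  exact add_le_add hnear hfar
end

section
/- Fix A > 0, R ≥ 0, r ∈ ℝ and C > 0. Let q₀ : (0,A) → ℂ be measurable with Q(x) := ∫₀^x t·|q₀(t)|/(1+R·t) dt < ∞ for every x ∈ (0,A). Let G : {(x,t) : 0 < t ≤ x < A} → ℂ satisfy |G(x,t)| ≤ C·(x/(1+R·x))^{1/2}·(t/(1+R·t))^{1/2}·e^{r(x−t)} for all 0 < t ≤ x < A. Let g₀ : (0,A) → ℂ be measurable with |g₀(x)| ≤ C·(x/(1+R·x))^{1/2}·e^{r·x}, and define recursively g_{k+1}(x) = −∫₀^x G(x,t)·q₀(t)·g_k(t) dt. Then for every k ∈ ℕ and every x ∈ (0,A), |g_k(x)| ≤ (C^{k+1}/k!) · (x/(1+R·x))^{1/2} · e^{r·x} · Q(x)^k.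 -/
open MeasureTheory

/-- Positive powers of an absolutely continuous real function are absolutely continuous. -/
theorem AbsolutelyContinuousOnInterval.fun_pow_succ {f : ℝ → ℝ} {a b : ℝ}
    (hf : AbsolutelyContinuousOnInterval f a b) (n : ℕ) :
    AbsolutelyContinuousOnInterval (fun x ↦ f x ^ (n + 1)) a b := by
  induction n with
  | zero => simpa using hf
  | succ n ih => simpa only [pow_succ _ (n + 1)] using ih.fun_mul hf

/-- Integrating an integrable function against a power of its primitive. -/
theorem IntervalIntegrable.integral_mul_primitive_pow {w : ℝ → ℝ} {a b : ℝ}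
    (hw : IntervalIntegrable w volume a b) (n : ℕ) :
    ∫ t in a..b, w t * (∫ s in a..t, w s) ^ n =
      (∫ t in a..b, w t) ^ (n + 1) / (n + 1 : ℝ) := by
  have hac := (hw.absolutelyContinuousOnInterval_intervalIntegral
    (c := a) Set.left_mem_uIcc).fun_pow_succ n
  have hftc := hac.integral_deriv_eq_sub
  have hderiv : ∫ x in a..b, deriv (fun x ↦ (∫ s in a..x, w s) ^ (n + 1)) x =
      ∫ x in a..b, (n + 1 : ℝ) * (w x * (∫ s in a..x, w s) ^ n) := by
    apply intervalIntegral.integral_congr_ae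
    filter_upwards [hw.ae_hasDerivAt_integral] with x hx hxab
    have hd := (hx (Set.uIoc_subset_uIcc hxab) a Set.left_mem_uIcc).fun_pow (n + 1)
    rw [hd.deriv]
    push_cast [Nat.add_sub_cancel]
    ring
  rw [hderiv, intervalIntegral.integral_const_mul] at hftc
  rw [eq_div_iff (by positivity), mul_comm, hftc]
  simp

/-- Inductive estimate on the iterates of the Volterra-type integral equation:
with `Q(x) = ∫₀^x t|q₀(t)|/(1+Rt) dt`, if `|G(x,t)| ≤ C√(x/(1+Rx))√(t/(1+Rt))e^{r(x−t)}`,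
`|g₀(x)| ≤ C√(x/(1+Rx))e^{rx}` and `g_{k+1}(x) = −∫₀^x G(x,t)q₀(t)g_k(t) dt`, then
`|g_k(x)| ≤ (C^{k+1}/k!)√(x/(1+Rx))e^{rx}Q(x)^k`. -/
theorem stmt5 (A R r C : ℝ) (hA : 0 < A) (hR : 0 ≤ R) (hC : 0 < C)
    (q₀ : ℝ → ℂ) (hq₀meas : Measurable q₀)
    (hQfin : ∀ x ∈ Set.Ioo (0 : ℝ) A,
      IntegrableOn (fun t : ℝ => t * ‖q₀ t‖ / (1 + R * t)) (Set.Ioo 0 x))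
    (G : ℝ → ℝ → ℂ)
    (hG : ∀ x t : ℝ, 0 < t → t ≤ x → x < A →
      ‖G x t‖ ≤ C * Real.sqrt (x / (1 + R * x)) * Real.sqrt (t / (1 + R * t)) *
        Real.exp (r * (x - t)))
    (g : ℕ → ℝ → ℂ)
    (hg0meas : AEStronglyMeasurable (g 0) (volume.restrict (Set.Ioo 0 A)))
    (hg0 : ∀ x ∈ Set.Ioo (0 : ℝ) A,
      ‖g 0 x‖ ≤ C * Real.sqrt (x / (1 + R * x)) * Real.exp (r * x))
    (hgrec : ∀ k : ℕ, ∀ x ∈ Set.Ioo (0 : ℝ) A,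
      g (k + 1) x = -∫ t in Set.Ioo (0 : ℝ) x, G x t * q₀ t * g k t) :
    ∀ k : ℕ, ∀ x ∈ Set.Ioo (0 : ℝ) A,
      ‖g k x‖ ≤ C ^ (k + 1) / (Nat.factorial k : ℝ) *
        Real.sqrt (x / (1 + R * x)) * Real.exp (r * x) *
        (∫ t in Set.Ioo (0 : ℝ) x, t * ‖q₀ t‖ / (1 + R * t)) ^ k := by
  set w : ℝ → ℝ := fun t ↦ t * ‖q₀ t‖ / (1 + R * t) with hw
  have hQ (x : ℝ) (hx : 0 ≤ x) : ∫ t in Set.Ioo 0 x, w t = ∫ t in (0 : ℝ)..x, w t := by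
    rw [intervalIntegral.integral_of_le hx, integral_Ioc_eq_integral_Ioo]
  intro k
  induction k with
  | zero => simpa using hg0
  | succ k ih =>
    intro x hx
    have hwx : IntervalIntegrable w volume 0 x :=
      (intervalIntegrable_iff_integrableOn_Ioo_of_le hx.1.le).2 (hQfin x hx)
    have hwQ : IntervalIntegrable (fun t ↦ w t * (∫ s in (0 : ℝ)..t, w s) ^ k) volume 0 x :=
      hwx.mul_continuousOn
        ((intervalIntegral.continuousOn_primitive_interval' hwx Set.left_mem_uIcc).pow k)
    set K : ℝ := C ^ (k + 2) / (k.factorial : ℝ) * Real.sqrt (x / (1 + R * x)) *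
      Real.exp (r * x) with hK
    have hbound : ∀ t ∈ Set.Ioo (0 : ℝ) x,
        ‖G x t * q₀ t * g k t‖ ≤ K * (w t * (∫ s in (0 : ℝ)..t, w s) ^ k) := by
      intro t ht
      have hGt := hG x t ht.1 ht.2.le hx.2
      have hgt := ih t ⟨ht.1, ht.2.trans hx.2⟩
      rw [hQ t ht.1.le] at hgt
      have hsq : Real.sqrt (t / (1 + R * t)) * Real.sqrt (t / (1 + R * t)) = t / (1 + R * t) :=
        Real.mul_self_sqrt (div_nonneg ht.1.le (by nlinarith [mul_nonneg hR ht.1.le]))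
      have hexp : Real.exp (r * (x - t)) * Real.exp (r * t) = Real.exp (r * x) := by
        rw [← Real.exp_add]
        ring_nf
      rw [norm_mul, norm_mul]
      calc
        _ ≤ C * Real.sqrt (x / (1 + R * x)) * Real.sqrt (t / (1 + R * t)) *
              Real.exp (r * (x - t)) * ‖q₀ t‖ *
            (C ^ (k + 1) / (k.factorial : ℝ) * Real.sqrt (t / (1 + R * t)) * Real.exp (r * t) *
              (∫ s in (0 : ℝ)..t, w s) ^ k) := by gcongr
        _ = C ^ (k + 2) / (k.factorial : ℝ) * Real.sqrt (x / (1 + R * x)) *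
              (Real.exp (r * (x - t)) * Real.exp (r * t)) *
            ((Real.sqrt (t / (1 + R * t)) * Real.sqrt (t / (1 + R * t))) * ‖q₀ t‖ *
              (∫ s in (0 : ℝ)..t, w s) ^ k) := by ring
        _ = _ := by
          rw [hsq, hexp, hK, hw]
          ring
    rw [hgrec k x hx, norm_neg, hQ x hx.1.le]
    calc
      _ ≤ ∫ t in Set.Ioo 0 x, K * (w t * (∫ s in (0 : ℝ)..t, w s) ^ k) :=
        norm_integral_le_of_norm_le
          ((intervalIntegrable_iff_integrableOn_Ioo_of_le hx.1.le).1 (hwQ.const_mul K))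
          ((ae_restrict_iff' measurableSet_Ioo).2 (.of_forall hbound))
      _ = K * ((∫ t in (0 : ℝ)..x, w t) ^ (k + 1) / (k + 1 : ℝ)) := by
        rw [← hwx.integral_mul_primitive_pow k, ← integral_Ioc_eq_integral_Ioo,
          ← intervalIntegral.integral_of_le hx.1.le, intervalIntegral.integral_const_mul]
      _ = _ := by
        rw [hK, Nat.factorial_succ]
        push_cast
        field_simp
end

section
/- Let λ ∈ ℝ \ {0} and A > 0, and let q : (0,A) → ℂ be continuous with q(x) = (−λ²−1/4)/x² + q₀(x), where ∫₀^{A/2} t·|q₀(t)| dt < ∞. Then there exists a function S : (0,A) × ℂ → ℂ such that: (i) for every μ ∈ ℂ, the map x ↦ S(x,μ) is twice continuously differentiable on (0,A) and satisfies −∂ₓ²S(x,μ) + q(x)·S(x,μ) = −μ²·S(x,μ) for all x ∈ (0,A); (ii) for every μ ∈ ℂ, S(x,μ)·x^{−1/2+iλ} → 1 as x → 0⁺, where x^{−1/2+iλ} is the principal-branch complex power; (iii) for every x ∈ (0,A), the map μ ↦ S(x,μ) is an entire function of μ and is even, i.e. S(x,μ) = S(x,−μ). -/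
open Filter MeasureTheory

/-- A Banach-space-valued integral of functions that depend holomorphically on a parameter is
holomorphic, provided the integrands are dominated on balls of the parameter space. -/
theorem differentiable_intervalIntegral_of_dominated {E : Type*} [NormedAddCommGroup E]
    [NormedSpace ℂ E] {F : ℂ → ℝ → E} {a b : ℝ} {bound : ℝ → ℝ → ℝ}
    (hmeas : ∀ z, AEStronglyMeasurable (F z) (volume.restrict (Set.uIoc a b)))
    (hdiff : ∀ t ∈ Set.uIoc a b, Differentiable ℂ (fun z => F z t))
    (hint : ∀ R, IntervalIntegrable (bound R) volume a b)
    (hbound : ∀ R, ∀ t ∈ Set.uIoc a b, ∀ z, ‖z‖ ≤ R → ‖F z t‖ ≤ bound R t) :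
    Differentiable ℂ (fun z => ∫ t in a..b, F z t) := by
  intro z₀
  have hd : ∀ t ∈ Set.uIoc a b, ∀ z, HasDerivAt (fun z => F z t) (deriv (fun z => F z t) z) z :=
    fun t ht z => (hdiff t ht z).hasDerivAt
  refine (intervalIntegral.hasDerivAt_integral_of_dominated_loc_of_deriv_le
    (F' := fun z t => deriv (fun z => F z t) z) (bound := bound (‖z₀‖ + 2))
    (Metric.ball_mem_nhds z₀ one_pos) (Eventually.of_forall hmeas) ?_ ?_ ?_ (hint _)
    (Eventually.of_forall fun t ht z _ => hd t ht z)).2.differentiableAt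
  · rw [intervalIntegrable_iff]
    refine Integrable.mono' (intervalIntegrable_iff.1 (hint ‖z₀‖)) (hmeas z₀) ?_
    exact (ae_restrict_iff' measurableSet_uIoc).2
      (Eventually.of_forall fun t ht => hbound _ t ht _ le_rfl)
  · have hlim : ∀ t ∈ Set.uIoc a b, Tendsto
        (fun n : ℕ => ((1 / ((n : ℝ) + 1) : ℝ) : ℂ)⁻¹ •
          (F (z₀ + ((1 / ((n : ℝ) + 1) : ℝ) : ℂ)) t - F z₀ t)) atTop
        (nhds (deriv (fun z => F z t) z₀)) := fun t ht => by
      refine (hasDerivAt_iff_tendsto_slope_zero.1 (hd t ht z₀)).comp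
        (tendsto_nhdsWithin_iff.2 ⟨?_, Eventually.of_forall fun n => ?_⟩)
      · have := (Complex.continuous_ofReal.tendsto 0).comp
          (tendsto_one_div_add_atTop_nhds_zero_nat (𝕜 := ℝ))
        simpa [Function.comp_def] using this
      · have : (1 / ((n : ℝ) + 1) : ℝ) ≠ 0 := by positivity
        simpa using (Complex.ofReal_ne_zero.2 this)
    refine aestronglyMeasurable_of_tendsto_ae atTop (fun n => ?_)
      ((ae_restrict_iff' measurableSet_uIoc).2 (Eventually.of_forall hlim))
    exact ((hmeas _).sub (hmeas _)).const_smul _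
  · refine Eventually.of_forall fun t ht z hz => ?_
    have h := Complex.norm_deriv_le_of_forall_mem_sphere_norm_le (c := z) (R := 1)
      (C := bound (‖z₀‖ + 2) t) one_pos (hdiff t ht).diffContOnCl fun w hw => ?_
    · simpa using h
    · refine hbound _ t ht w ?_
      have h1 : ‖w - z‖ = 1 := by simpa [dist_eq_norm] using hw
      have h2 : ‖z - z₀‖ < 1 := by simpa [dist_eq_norm] using hz
      have h3 : w = (w - z) + (z - z₀) + z₀ := by ring
      have h4 : ‖w‖ ≤ ‖w - z‖ + ‖z - z₀‖ + ‖z₀‖ := by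
        conv_lhs => rw [h3]
        exact norm_add₃_le
      linarith

section LinearODE

variable {E : Type*} [NormedAddCommGroup E]

/-- On an open interval, a continuous function with an integrable majorant up to the left endpoint
is interval integrable. -/
theorem intervalIntegrable_of_continuousOn_Ioo {A x : ℝ} {f : ℝ → E}
    {g : ℝ → ℝ} (hx : x ∈ Set.Ioo 0 A) (hf : ContinuousOn f (Set.Ioo 0 A))
    (hg : IntervalIntegrable g volume 0 x) (hfg : ∀ t ∈ Set.Ioo 0 A, ‖f t‖ ≤ g t) :
    IntervalIntegrable f volume 0 x := by
  rw [intervalIntegrable_iff_integrableOn_Ioc_of_le hx.1.le] at hg ⊢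
  have hsub : Set.Ioc 0 x ⊆ Set.Ioo 0 A := fun t ht => ⟨ht.1, ht.2.trans_lt hx.2⟩
  exact Integrable.mono' hg ((hf.mono hsub).aestronglyMeasurable measurableSet_Ioc)
    ((ae_restrict_iff' measurableSet_Ioc).2 (Eventually.of_forall fun t ht => hfg t (hsub ht)))

theorem hasDerivAt_integral_of_continuousOn_Ioo [NormedSpace ℝ E] [CompleteSpace E] {A x : ℝ}
    {f : ℝ → E} (hx : x ∈ Set.Ioo 0 A) (hf : ContinuousOn f (Set.Ioo 0 A))
    (hint : IntervalIntegrable f volume 0 x) :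
    HasDerivAt (fun u => ∫ t in (0 : ℝ)..u, f t) (f x) x :=
  intervalIntegral.integral_hasDerivAt_right hint
    (hf.stronglyMeasurableAtFilter isOpen_Ioo x hx) (hf.continuousAt (isOpen_Ioo.mem_nhds hx))

theorem continuousOn_primitive_Icc {x : ℝ} {b : ℝ → ℝ} (hx : 0 ≤ x)
    (hint : IntervalIntegrable b volume 0 x) :
    ContinuousOn (fun u => ∫ t in (0 : ℝ)..u, b t) (Set.Icc 0 x) := by
  have h := intervalIntegral.continuousOn_primitive_interval (μ := volume) (f := b) (a := 0)
    (b := x) (by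
      rw [Set.uIcc_of_le hx]
      exact (intervalIntegrable_iff_integrableOn_Icc_of_le hx).1 hint)
  rwa [Set.uIcc_of_le hx] at h

theorem intervalIntegrable_mul_primitive_pow {x : ℝ} {b : ℝ → ℝ} (hx : 0 ≤ x)
    (hint : IntervalIntegrable b volume 0 x) (n : ℕ) (C : ℝ) :
    IntervalIntegrable (fun t => b t * ((∫ s in (0 : ℝ)..t, b s) ^ n / n.factorial * C))
      volume 0 x := by
  refine hint.mul_continuousOn ?_
  rw [Set.uIcc_of_le hx]
  exact (((continuousOn_primitive_Icc hx hint).pow n).div_const _).mul_const _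

theorem integral_mul_primitive_pow {A x : ℝ} {b : ℝ → ℝ} (hx : x ∈ Set.Ioo 0 A)
    (hb : ContinuousOn b (Set.Ioo 0 A))
    (hint : ∀ y ∈ Set.Ioo 0 A, IntervalIntegrable b volume 0 y) (n : ℕ) (C : ℝ) :
    ∫ t in (0 : ℝ)..x, b t * ((∫ s in (0 : ℝ)..t, b s) ^ n / n.factorial * C) =
      (∫ s in (0 : ℝ)..x, b s) ^ (n + 1) / (n + 1).factorial * C := by
  rw [intervalIntegral.integral_eq_sub_of_hasDerivAt_of_le
    (f := fun u => (∫ s in (0 : ℝ)..u, b s) ^ (n + 1) / (n + 1).factorial * C) hx.1.le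
    ((((continuousOn_primitive_Icc hx.1.le (hint x hx)).pow _).div_const _).mul_const _) ?_
    (intervalIntegrable_mul_primitive_pow hx.1.le (hint x hx) n C)]
  · simp
  · intro t ht
    have ht' : t ∈ Set.Ioo 0 A := ⟨ht.1, ht.2.trans hx.2⟩
    have h := (((hasDerivAt_integral_of_continuousOn_Ioo ht' hb (hint t ht')).pow
      (n + 1)).div_const ((n + 1).factorial : ℝ)).mul_const C
    refine h.congr_deriv ?_
    rw [Nat.factorial_succ]
    have : (n.factorial : ℝ) ≠ 0 := by positivity
    push_cast
    field_simp

variable [NormedSpace ℂ E]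

/-- The terms of the Picard (Dyson) series for `y' = M(t, z) y` with initial value `e` at `0`. -/
noncomputable def picardTerm (M : ℝ → ℂ → E →L[ℂ] E) (e : E) : ℕ → ℝ → ℂ → E
  | 0, _, _ => e
  | n + 1, x, z => ∫ t in (0 : ℝ)..x, M t z (picardTerm M e n t z)

variable {A : ℝ} {M : ℝ → ℂ → E →L[ℂ] E} {b : ℝ → ℝ} {z : ℂ}

theorem norm_apply_picardTerm_le (hMb : ∀ t ∈ Set.Ioo 0 A, ‖M t z‖ ≤ b t) (e : E) {n : ℕ}
    (h : ∀ x ∈ Set.Ioo 0 A,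
      ‖picardTerm M e n x z‖ ≤ (∫ s in (0 : ℝ)..x, b s) ^ n / n.factorial * ‖e‖) :
    ∀ t ∈ Set.Ioo 0 A, ‖M t z (picardTerm M e n t z)‖ ≤
      b t * ((∫ s in (0 : ℝ)..t, b s) ^ n / n.factorial * ‖e‖) := fun t ht =>
  (M t z).le_of_opNorm_le_of_le (hMb t ht) (h t ht)

theorem picardTerm_continuousOn_and_norm_le [CompleteSpace E]
    (hMc : ContinuousOn (fun t => M t z) (Set.Ioo 0 A))
    (hb : ContinuousOn b (Set.Ioo 0 A))
    (hint : ∀ y ∈ Set.Ioo 0 A, IntervalIntegrable b volume 0 y)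
    (hMb : ∀ t ∈ Set.Ioo 0 A, ‖M t z‖ ≤ b t) (e : E) (n : ℕ) :
    ContinuousOn (fun x => picardTerm M e n x z) (Set.Ioo 0 A) ∧ ∀ x ∈ Set.Ioo 0 A,
      ‖picardTerm M e n x z‖ ≤ (∫ s in (0 : ℝ)..x, b s) ^ n / n.factorial * ‖e‖ := by
  induction n with
  | zero => exact ⟨continuousOn_const, fun x _ => by simp [picardTerm]⟩
  | succ n ih =>
    have hle := norm_apply_picardTerm_le hMb e ih.2
    have hcont := hMc.clm_apply ih.1
    refine ⟨fun x hx => ?_, fun x hx => ?_⟩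
    · exact (hasDerivAt_integral_of_continuousOn_Ioo hx hcont
        (intervalIntegrable_of_continuousOn_Ioo hx hcont
          (intervalIntegrable_mul_primitive_pow hx.1.le (hint x hx) n ‖e‖)
          hle)).continuousAt.continuousWithinAt
    · rw [← integral_mul_primitive_pow hx hb hint]
      exact intervalIntegral.norm_integral_le_of_norm_le hx.1.le
        (Eventually.of_forall fun t ht => hle t ⟨ht.1, ht.2.trans_lt hx.2⟩)
        (intervalIntegrable_mul_primitive_pow hx.1.le (hint x hx) n ‖e‖)

theorem picardTerm_differentiable [CompleteSpace E] {b : ℝ → ℝ → ℝ}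
    (hMc : ∀ z, ContinuousOn (fun t => M t z) (Set.Ioo 0 A))
    (hMd : ∀ t ∈ Set.Ioo 0 A, Differentiable ℂ (M t))
    (hb : ∀ R, ContinuousOn (b R) (Set.Ioo 0 A))
    (hint : ∀ R, ∀ y ∈ Set.Ioo 0 A, IntervalIntegrable (b R) volume 0 y)
    (hMb : ∀ R, ∀ t ∈ Set.Ioo 0 A, ∀ z, ‖z‖ ≤ R → ‖M t z‖ ≤ b R t) (e : E) (n : ℕ) :
    ∀ x ∈ Set.Ioo 0 A, Differentiable ℂ (picardTerm M e n x) := by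
  induction n with
  | zero => exact fun x _ => differentiable_const e
  | succ n ih =>
    intro x hx
    have hsub : Set.uIoc 0 x ⊆ Set.Ioo 0 A := by
      rw [Set.uIoc_of_le hx.1.le]
      exact fun t ht => ⟨ht.1, ht.2.trans_lt hx.2⟩
    have hP := fun z R (hz : ‖z‖ ≤ R) => picardTerm_continuousOn_and_norm_le (hMc z) (hb R)
      (hint R) (fun t ht => hMb R t ht z hz) e n
    refine differentiable_intervalIntegral_of_dominated
      (fun z => (((hMc z).clm_apply (hP z _ le_rfl).1).mono hsub).aestronglyMeasurable
        measurableSet_uIoc)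
      (fun t ht => (hMd t (hsub ht)).clm_apply (ih t (hsub ht)))
      (fun R => intervalIntegrable_mul_primitive_pow hx.1.le (hint R x hx) n ‖e‖)
      fun R t ht z hz => norm_apply_picardTerm_le (fun t ht => hMb R t ht z hz) e (hP z R hz).2 t
        (hsub ht)

/-- A linear system `y' = M(t, z) y` whose coefficients are integrable up to the left endpoint,
locally uniformly in the parameter `z`, and holomorphic in `z`, has a solution with prescribed
limit at the left endpoint which is entire in `z`. -/
theorem exists_linearODE_solution_entire [CompleteSpace E] {b : ℝ → ℝ → ℝ}
    (hMc : ∀ z, ContinuousOn (fun t => M t z) (Set.Ioo 0 A))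
    (hMd : ∀ t ∈ Set.Ioo 0 A, Differentiable ℂ (M t)) (hA : 0 < A)
    (hb : ∀ R, ContinuousOn (b R) (Set.Ioo 0 A))
    (hint : ∀ R, ∀ y ∈ Set.Ioo 0 A, IntervalIntegrable (b R) volume 0 y)
    (hMb : ∀ R, ∀ t ∈ Set.Ioo 0 A, ∀ z, ‖z‖ ≤ R → ‖M t z‖ ≤ b R t) (e : E) :
    ∃ Y : ℝ → ℂ → E,
      (∀ z, ∀ x ∈ Set.Ioo 0 A, HasDerivAt (fun t => Y t z) (M x z (Y x z)) x) ∧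
      (∀ z, Tendsto (fun t => Y t z) (nhdsWithin 0 (Set.Ioi 0)) (nhds e)) ∧
      ∀ x ∈ Set.Ioo 0 A, Differentiable ℂ (Y x) := by
  have hP := fun z R (hz : ‖z‖ ≤ R) n => picardTerm_continuousOn_and_norm_le (hMc z) (hb R)
    (hint R) (fun t ht => hMb R t ht z hz) e n
  have hsum : ∀ G : ℝ, Summable fun n : ℕ => G ^ n / n.factorial * ‖e‖ := fun G =>
    (Real.summable_pow_div_factorial G).mul_right _
  have hsumm : ∀ z, ∀ x ∈ Set.Ioo 0 A, Summable fun n => picardTerm M e n x z := fun z x hx =>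
    Summable.of_norm_bounded (hsum _) fun n => (hP z _ le_rfl n).2 x hx
  -- monotonicity of the primitives of the majorants
  have hmono : ∀ R, 0 ≤ R → ∀ x ∈ Set.Ioo 0 A, ∀ t ∈ Set.Ioc 0 x,
      0 ≤ (∫ s in (0 : ℝ)..t, b R s) ∧
        (∫ s in (0 : ℝ)..t, b R s) ≤ ∫ s in (0 : ℝ)..x, b R s := by
    intro R hR x hx t ht
    have hb0 : ∀ s ∈ Set.Ioo 0 A, 0 ≤ b R s := fun s hs =>
      (norm_nonneg _).trans (hMb R s hs 0 (by simpa using hR))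
    have h0 : ∀ᵐ s ∂volume.restrict (Set.Ioc 0 x), 0 ≤ b R s :=
      (ae_restrict_iff' measurableSet_Ioc).2
        (Eventually.of_forall fun s hs => hb0 s ⟨hs.1, hs.2.trans_lt hx.2⟩)
    refine ⟨intervalIntegral.integral_nonneg_of_ae_restrict ht.1.le ?_,
      intervalIntegral.integral_mono_interval le_rfl ht.1.le ht.2 h0 (hint R x hx)⟩
    rw [← Measure.restrict_congr_set Ioc_ae_eq_Icc]
    exact ae_restrict_of_ae_restrict_of_subset (Set.Ioc_subset_Ioc_right ht.2) h0
  have hle : ∀ z, ∀ x ∈ Set.Ioo 0 A, ∀ t ∈ Set.Ioc 0 x, ∀ n,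
      ‖picardTerm M e n t z‖ ≤ (∫ s in (0 : ℝ)..x, b ‖z‖ s) ^ n / n.factorial * ‖e‖ := by
    intro z x hx t ht n
    refine ((hP z _ le_rfl n).2 t ⟨ht.1, ht.2.trans_lt hx.2⟩).trans ?_
    have h := hmono ‖z‖ (norm_nonneg z) x hx t ht
    have h0 := h.1
    gcongr
    exact h.2
  have hcont : ∀ z, ContinuousOn (fun t => ∑' n, picardTerm M e n t z) (Set.Ioo 0 A) := by
    intro z x hx
    obtain ⟨y, hxy, hyA⟩ := exists_between hx.2
    have hy : y ∈ Set.Ioo 0 A := ⟨hx.1.trans hxy, hyA⟩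
    have hsub : Set.Ioo 0 y ⊆ Set.Ioo 0 A := Set.Ioo_subset_Ioo_right hyA.le
    have h : ContinuousOn (fun t => ∑' n, picardTerm M e n t z) (Set.Ioo 0 y) :=
      continuousOn_tsum (fun n => ((hP z _ le_rfl n).1).mono hsub) (hsum _)
        (fun n t ht => hle z y hy t ⟨ht.1, ht.2.le⟩ n)
    exact (h.continuousAt (isOpen_Ioo.mem_nhds ⟨hx.1, hxy⟩)).continuousWithinAt
  have hMYc : ∀ z, ContinuousOn (fun t => M t z (∑' n, picardTerm M e n t z)) (Set.Ioo 0 A) :=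
    fun z => (hMc z).clm_apply (hcont z)
  have hMYint : ∀ z, ∀ x ∈ Set.Ioo 0 A,
      IntervalIntegrable (fun t => M t z (∑' n, picardTerm M e n t z)) volume 0 x ∧
      ∑' n, picardTerm M e n x z = e + ∫ t in (0 : ℝ)..x, M t z (∑' n, picardTerm M e n t z) := by
    intro z x hx
    set B := fun n : ℕ => (∫ s in (0 : ℝ)..x, b ‖z‖ s) ^ n / n.factorial * ‖e‖
    have hsub : Set.uIoc 0 x ⊆ Set.Ioo 0 A := by
      rw [Set.uIoc_of_le hx.1.le]
      exact fun t ht => ⟨ht.1, ht.2.trans_lt hx.2⟩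
    have hbd : ∀ n, ∀ t ∈ Set.uIoc 0 x, ‖M t z (picardTerm M e n t z)‖ ≤ b ‖z‖ t * B n := by
      intro n t ht
      exact (M t z).le_of_opNorm_le_of_le (hMb _ t (hsub ht) z le_rfl)
        (hle z x hx t (by rwa [Set.uIoc_of_le hx.1.le] at ht) n)
    have hbsum : IntervalIntegrable (fun t => ∑' n, b ‖z‖ t * B n) volume 0 x := by
      simp_rw [tsum_mul_left]
      exact (hint _ x hx).mul_const _
    have H := intervalIntegral.hasSum_integral_of_dominated_convergence (μ := volume)
      (F := fun n t => M t z (picardTerm M e n t z))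
      (f := fun t => M t z (∑' n, picardTerm M e n t z))
      (fun n t => b ‖z‖ t * B n)
      (fun n => (((hMc z).clm_apply (hP z _ le_rfl n).1).mono hsub).aestronglyMeasurable
        measurableSet_uIoc)
      (fun n => Eventually.of_forall (hbd n))
      (Eventually.of_forall fun t _ => (hsum _).mul_left _) hbsum
      (Eventually.of_forall fun t ht => (M t z).hasSum (hsumm z t (hsub ht)).hasSum)
    refine ⟨?_, ?_⟩
    · rw [intervalIntegrable_iff] at hbsum ⊢
      refine Integrable.mono' hbsum (((hMYc z).mono hsub).aestronglyMeasurable measurableSet_uIoc)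
        ((ae_restrict_iff' measurableSet_uIoc).2 (Eventually.of_forall fun t ht => ?_))
      rw [(M t z).map_tsum (hsumm z t (hsub ht))]
      exact tsum_of_norm_bounded ((hsum _).mul_left _).hasSum fun n => hbd n t ht
    · rw [(hsumm z x hx).tsum_eq_zero_add, ← H.tsum_eq]
      rfl
  refine ⟨fun x z => ∑' n, picardTerm M e n x z, fun z x hx => ?_, fun z => ?_, fun x hx => ?_⟩
  · refine ((hasDerivAt_integral_of_continuousOn_Ioo hx (hMYc z)
      (hMYint z x hx).1).const_add e).congr_of_eventuallyEq ?_
    filter_upwards [isOpen_Ioo.mem_nhds hx] with t ht using (hMYint z t ht).2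
  · have hA2 : A / 2 ∈ Set.Ioo 0 A := ⟨by linarith, by linarith⟩
    have hprim := intervalIntegral.continuousOn_primitive_interval (μ := volume)
      (f := fun t => M t z (∑' n, picardTerm M e n t z)) (a := 0) (b := A / 2)
      (by rw [Set.uIcc_of_le hA2.1.le]
          exact (intervalIntegrable_iff_integrableOn_Icc_of_le hA2.1.le).1 (hMYint z _ hA2).1)
    have h0 := (hprim 0 Set.left_mem_uIcc).mono_of_mem_nhdsWithin (s := Set.Ioo 0 (A / 2)) <| by
      rw [Set.uIcc_of_le hA2.1.le]
      exact mem_of_superset self_mem_nhdsWithin Set.Ioo_subset_Icc_self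
    have h1 := h0.tendsto.const_add e
    rw [intervalIntegral.integral_same, add_zero, nhdsWithin_Ioo_eq_nhdsGT hA2.1] at h1
    refine h1.congr' ?_
    filter_upwards [Ioo_mem_nhdsGT hA] with t ht using (hMYint z t ht).2.symm
  · intro z
    have h := Complex.differentiableOn_tsum_of_summable_norm
      (hsum (∫ s in (0 : ℝ)..x, b (‖z‖ + 1) s))
      (F := fun n => picardTerm M e n x)
      (fun n => (picardTerm_differentiable hMc hMd hb hint hMb e n x hx).differentiableOn)
      (Metric.isOpen_ball (x := (0 : ℂ)) (ε := ‖z‖ + 1)) (fun n w hw =>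
        (hP w (‖z‖ + 1) (by simpa using (mem_ball_zero_iff.1 hw).le) n).2 x hx)
    exact h.differentiableAt (Metric.isOpen_ball.mem_nhds (by simp))

end LinearODE

/-- The coefficient matrix of the system satisfied by the amplitudes `(α, β)` when variation of
parameters is applied to `u = α x^{1/2-iλ} + β x^{1/2+iλ}`, without the factor `t (q₀(t) + μ²)`. -/
noncomputable def amplitudeMatrix (lam t : ℝ) : ℂ × ℂ →L[ℂ] ℂ × ℂ :=
  (1 / (2 * Complex.I * lam)) •
    ((t : ℂ) ^ (-(2 * (Complex.I * lam))) •
        (ContinuousLinearMap.inr ℂ ℂ ℂ).comp (ContinuousLinearMap.fst ℂ ℂ ℂ) +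
      (ContinuousLinearMap.inr ℂ ℂ ℂ).comp (ContinuousLinearMap.snd ℂ ℂ ℂ) -
      (ContinuousLinearMap.inl ℂ ℂ ℂ).comp (ContinuousLinearMap.fst ℂ ℂ ℂ) -
      (t : ℂ) ^ (2 * (Complex.I * lam)) •
        (ContinuousLinearMap.inl ℂ ℂ ℂ).comp (ContinuousLinearMap.snd ℂ ℂ ℂ))

theorem amplitudeMatrix_apply (lam t : ℝ) (y : ℂ × ℂ) :
    amplitudeMatrix lam t y =
      (1 / (2 * Complex.I * lam) * (-y.1 - (t : ℂ) ^ (2 * (Complex.I * lam)) * y.2),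
        1 / (2 * Complex.I * lam) * ((t : ℂ) ^ (-(2 * (Complex.I * lam))) * y.1 + y.2)) := by
  ext <;> simp [amplitudeMatrix]

theorem continuousOn_ofReal_cpow_const (s : ℂ) :
    ContinuousOn (fun t : ℝ => (t : ℂ) ^ s) (Set.Ioi 0) := fun t ht =>
  (Complex.continuousAt_ofReal_cpow_const t s (Or.inr (ne_of_gt ht))).continuousWithinAt

theorem amplitudeMatrix_continuousOn (lam : ℝ) :
    ContinuousOn (amplitudeMatrix lam) (Set.Ioi 0) := by
  have h1 := continuousOn_ofReal_cpow_const (2 * (Complex.I * lam))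
  have h2 := continuousOn_ofReal_cpow_const (-(2 * (Complex.I * lam)))
  unfold amplitudeMatrix
  fun_prop

theorem exists_norm_amplitudeMatrix_le (lam : ℝ) :
    ∃ K, ∀ t : ℝ, 0 < t → ‖amplitudeMatrix lam t‖ ≤ K := by
  refine ⟨‖1 / (2 * Complex.I * lam)‖ *
    (‖(ContinuousLinearMap.inr ℂ ℂ ℂ).comp (ContinuousLinearMap.fst ℂ ℂ ℂ)‖ +
      ‖(ContinuousLinearMap.inr ℂ ℂ ℂ).comp (ContinuousLinearMap.snd ℂ ℂ ℂ)‖ +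
      ‖(ContinuousLinearMap.inl ℂ ℂ ℂ).comp (ContinuousLinearMap.fst ℂ ℂ ℂ)‖ +
      ‖(ContinuousLinearMap.inl ℂ ℂ ℂ).comp (ContinuousLinearMap.snd ℂ ℂ ℂ)‖),
    fun t ht => ?_⟩
  have h1 : ‖(t : ℂ) ^ (2 * (Complex.I * lam))‖ = 1 := by
    rw [Complex.norm_cpow_eq_rpow_re_of_pos ht]; simp
  have h2 : ‖(t : ℂ) ^ (-(2 * (Complex.I * lam)))‖ = 1 := by
    rw [Complex.norm_cpow_eq_rpow_re_of_pos ht]; simp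
  rw [amplitudeMatrix, norm_smul]
  refine mul_le_mul_of_nonneg_left ((norm_sub_le _ _).trans (add_le_add
    ((norm_sub_le _ _).trans (add_le_add ((norm_add_le _ _).trans (add_le_add ?_ le_rfl)) le_rfl))
    ?_)) (norm_nonneg _)
  · rw [norm_smul, h2, one_mul]
  · rw [norm_smul, h1, one_mul]

/-- If `t ‖f(t)‖` is integrable near `0` and `f` is continuous on `(0, A)`, then `t ‖f(t)‖` is
integrable on `(0, y)` for each `y < A`. -/
theorem intervalIntegrable_mul_norm {A y : ℝ} {f : ℝ → ℂ} (hf : ContinuousOn f (Set.Ioo 0 A))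
    (hint : IntegrableOn (fun t : ℝ => t * ‖f t‖) (Set.Ioo 0 (A / 2))) (hy : y ∈ Set.Ioo 0 A) :
    IntervalIntegrable (fun t : ℝ => t * ‖f t‖) volume 0 y := by
  have hA : 0 < A := hy.1.trans hy.2
  have h1 : IntervalIntegrable (fun t : ℝ => t * ‖f t‖) volume 0 (A / 2) := by
    rwa [intervalIntegrable_iff_integrableOn_Ioo_of_le (by linarith)]
  refine h1.trans (ContinuousOn.intervalIntegrable ?_)
  refine (continuousOn_id.mul hf.norm).mono fun t ht => ?_
  rw [Set.mem_uIcc] at ht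
  have := hy.1
  have := hy.2
  constructor <;> rcases ht with ht | ht <;> linarith [ht.1, ht.2]

/-- Amplitudes `(α, β)` with limit `(1, 0)` at the origin, entire in the spectral parameter. -/
theorem exists_amplitudes {lam A : ℝ} (hA : 0 < A) {q₀ : ℝ → ℂ}
    (hcont : ContinuousOn q₀ (Set.Ioo 0 A))
    (hint : IntegrableOn (fun t : ℝ => t * ‖q₀ t‖) (Set.Ioo 0 (A / 2))) :
    ∃ Y : ℝ → ℂ → ℂ × ℂ,
      (∀ z, ∀ x ∈ Set.Ioo 0 A,
        HasDerivAt (fun t => Y t z) ((x * (q₀ x + z)) • amplitudeMatrix lam x (Y x z)) x) ∧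
      (∀ z, Tendsto (fun t => Y t z) (nhdsWithin 0 (Set.Ioi 0)) (nhds (1, 0))) ∧
      ∀ x ∈ Set.Ioo 0 A, Differentiable ℂ (Y x) := by
  obtain ⟨K, hK⟩ := exists_norm_amplitudeMatrix_le lam
  have hN : ContinuousOn (amplitudeMatrix lam) (Set.Ioo 0 A) :=
    (amplitudeMatrix_continuousOn lam).mono fun t ht => ht.1
  refine exists_linearODE_solution_entire (b := fun R t => t * (‖q₀ t‖ + R) * K)
    (M := fun t z => ((t : ℂ) * (q₀ t + z)) • amplitudeMatrix lam t)
    (fun z => by fun_prop) (fun t _ => by fun_prop) hA (fun R => by fun_prop)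
    (fun R y hy => ?_) (fun R t ht z hz => ?_) (1, 0)
  · refine IntervalIntegrable.mul_const ?_ K
    simp_rw [mul_add]
    exact (intervalIntegrable_mul_norm hcont hint hy).add
      ((continuous_id.mul continuous_const).intervalIntegrable _ _)
  · rw [norm_smul, norm_mul, Complex.norm_real, Real.norm_of_nonneg ht.1.le]
    have h1 : ‖q₀ t + z‖ ≤ ‖q₀ t‖ + R := (norm_add_le _ _).trans (by gcongr)
    have h2 := hK t ht.1
    have h3 := ht.1.le
    have h4 := (norm_nonneg _).trans h1
    gcongr

/-- Variation of parameters for `u'' = (-(λ² + 1/4) / x² + p) u`: derivative identities for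
`u = α x^{1/2-iλ} + β x^{1/2+iλ}`. -/
theorem hasDerivAt_of_amplitudes {lam x : ℝ} (hlam : lam ≠ 0) (hx : 0 < x) {p : ℂ}
    {Y : ℝ → ℂ × ℂ} (hY : HasDerivAt Y ((x * p) • amplitudeMatrix lam x (Y x)) x) :
    HasDerivAt (fun t : ℝ => (Y t).1 * (t : ℂ) ^ (1 / 2 - Complex.I * lam) +
        (Y t).2 * (t : ℂ) ^ (1 / 2 + Complex.I * lam))
      ((1 / 2 - Complex.I * lam) * ((Y x).1 * (x : ℂ) ^ (1 / 2 - Complex.I * lam - 1)) +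
        (1 / 2 + Complex.I * lam) * ((Y x).2 * (x : ℂ) ^ (1 / 2 + Complex.I * lam - 1))) x ∧
    HasDerivAt (fun t : ℝ =>
        (1 / 2 - Complex.I * lam) * ((Y t).1 * (t : ℂ) ^ (1 / 2 - Complex.I * lam - 1)) +
        (1 / 2 + Complex.I * lam) * ((Y t).2 * (t : ℂ) ^ (1 / 2 + Complex.I * lam - 1)))
      (((-(lam : ℂ) ^ 2 - 1 / 4) / (x : ℂ) ^ 2 + p) *
        ((Y x).1 * (x : ℂ) ^ (1 / 2 - Complex.I * lam) +
          (Y x).2 * (x : ℂ) ^ (1 / 2 + Complex.I * lam))) x := by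
  have hx0 : (x : ℂ) ≠ 0 := Complex.ofReal_ne_zero.2 hx.ne'
  have hl : (lam : ℂ) ≠ 0 := Complex.ofReal_ne_zero.2 hlam
  have hI0 := Complex.I_ne_zero
  rw [amplitudeMatrix_apply] at hY
  have hY1 := (ContinuousLinearMap.fst ℝ ℂ ℂ).hasFDerivAt.comp_hasDerivAt x hY
  have hY2 := (ContinuousLinearMap.snd ℝ ℂ ℂ).hasFDerivAt.comp_hasDerivAt x hY
  have hpow : ∀ s : ℂ, s ≠ 0 →
      HasDerivAt (fun t : ℝ => (t : ℂ) ^ s) (s * (x : ℂ) ^ (s - 1)) x := fun s hs =>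
    hasDerivAt_ofReal_cpow_const hx.ne' hs
  have hre : ∀ s : ℂ, s.re ≠ 0 → s ≠ 0 := fun s hs h => hs (by simp [h])
  have hw : (x : ℂ) ^ (Complex.I * lam) ≠ 0 := by simp [Complex.cpow_eq_zero_iff, hx0]
  have e1 : (x : ℂ) ^ (2 * (Complex.I * lam)) = ((x : ℂ) ^ (Complex.I * lam)) ^ 2 := by
    rw [Complex.cpow_ofNat_mul]
  have e2 : (x : ℂ) ^ (-(2 * (Complex.I * lam))) = (((x : ℂ) ^ (Complex.I * lam)) ^ 2)⁻¹ := by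
    rw [Complex.cpow_neg, e1]
  have e3 : (x : ℂ) ^ (1 / 2 - Complex.I * lam) =
      (x : ℂ) ^ (1 / 2 : ℂ) / (x : ℂ) ^ (Complex.I * lam) := Complex.cpow_sub _ _ hx0
  have e4 : (x : ℂ) ^ (1 / 2 + Complex.I * lam) =
      (x : ℂ) ^ (1 / 2 : ℂ) * (x : ℂ) ^ (Complex.I * lam) := Complex.cpow_add _ _ hx0
  have e5 : ∀ s : ℂ, (x : ℂ) ^ (s - 1) = (x : ℂ) ^ s / x := fun s => by
    rw [Complex.cpow_sub _ _ hx0, Complex.cpow_one]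
  constructor
  · refine ((hY1.mul (hpow (1 / 2 - Complex.I * lam) (hre _ (by simp)))).add
      (hY2.mul (hpow (1 / 2 + Complex.I * lam) (hre _ (by simp))))).congr_deriv ?_
    simp only [e1, e2, e5, e3, e4, Function.comp_apply, ContinuousLinearMap.coe_fst',
      ContinuousLinearMap.coe_snd', Prod.smul_fst, Prod.smul_snd, smul_eq_mul]
    field_simp
    ring
  · refine (((hY1.mul (hpow (1 / 2 - Complex.I * lam - 1) (hre _ (by norm_num)))).const_mul _).add
      ((hY2.mul (hpow (1 / 2 + Complex.I * lam - 1) (hre _ (by norm_num)))).const_mul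
        _)).congr_deriv ?_
    simp only [e1, e2, e5, e3, e4, Function.comp_apply, ContinuousLinearMap.coe_fst',
      ContinuousLinearMap.coe_snd', Prod.smul_fst, Prod.smul_snd, smul_eq_mul]
    field_simp
    ring_nf
    simp only [Complex.I_pow_three]
    ring

/-- The asymptotics at the origin of `α x^{1/2-iλ} + β x^{1/2+iλ}` when `(α, β) → (1, 0)`. -/
theorem tendsto_of_amplitudes {lam : ℝ} {Y : ℝ → ℂ × ℂ}
    (hY : Tendsto Y (nhdsWithin 0 (Set.Ioi 0)) (nhds (1, 0))) :
    Tendsto (fun x : ℝ => ((Y x).1 * (x : ℂ) ^ (1 / 2 - Complex.I * lam) +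
        (Y x).2 * (x : ℂ) ^ (1 / 2 + Complex.I * lam)) *
        (x : ℂ) ^ ((-1/2 : ℂ) + Complex.I * lam))
      (nhdsWithin 0 (Set.Ioi 0)) (nhds 1) := by
  have h1 : Tendsto (fun x => (Y x).1) (nhdsWithin 0 (Set.Ioi 0)) (nhds 1) :=
    (continuous_fst.tendsto _).comp hY
  have h2 : Tendsto (fun x => (Y x).2) (nhdsWithin 0 (Set.Ioi 0)) (nhds 0) :=
    (continuous_snd.tendsto _).comp hY
  have h3 : Tendsto (fun x : ℝ => (Y x).2 * (x : ℂ) ^ (2 * (Complex.I * lam)))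
      (nhdsWithin 0 (Set.Ioi 0)) (nhds 0) := by
    rw [tendsto_zero_iff_norm_tendsto_zero] at h2 ⊢
    refine h2.congr' ?_
    filter_upwards [self_mem_nhdsWithin] with x hx
    rw [norm_mul, Complex.norm_cpow_eq_rpow_re_of_pos hx]
    simp
  have h4 := h1.add h3
  rw [add_zero] at h4
  refine h4.congr' ?_
  filter_upwards [self_mem_nhdsWithin] with x hx
  have hx0 : (x : ℂ) ≠ 0 := Complex.ofReal_ne_zero.2 (ne_of_gt hx)
  rw [add_mul, mul_assoc, mul_assoc, ← Complex.cpow_add _ _ hx0, ← Complex.cpow_add _ _ hx0]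
  ring_nf
  simp

/-- Existence of the Jost-type solution `S₁₀` of `−u'' + q u = −μ² u` at the regular
singular endpoint `x = 0`, with prescribed asymptotics `x^{1/2−iλ}` and entire, even
dependence on the complex angular momentum `μ`. -/
theorem stmt7 (lam A : ℝ) (hlam : lam ≠ 0) (hA : 0 < A)
    (q q₀ : ℝ → ℂ) (hqcont : ContinuousOn q (Set.Ioo 0 A))
    (hq : ∀ x ∈ Set.Ioo (0 : ℝ) A,
      q x = (-(lam : ℂ) ^ 2 - 1/4) / (x : ℂ) ^ 2 + q₀ x)
    (hq₀ : IntegrableOn (fun t : ℝ => t * ‖q₀ t‖) (Set.Ioo 0 (A/2))) :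
    ∃ S : ℝ → ℂ → ℂ,
      (∀ μ : ℂ, ∀ x ∈ Set.Ioo (0 : ℝ) A,
        DifferentiableAt ℝ (fun x' => S x' μ) x ∧
        DifferentiableAt ℝ (deriv (fun x' => S x' μ)) x ∧
        ContinuousAt (deriv (deriv (fun x' => S x' μ))) x ∧
        -(deriv (deriv (fun x' => S x' μ)) x) + q x * S x μ = -μ ^ 2 * S x μ) ∧
      (∀ μ : ℂ,
        Tendsto (fun x : ℝ => S x μ * (x : ℂ) ^ ((-1/2 : ℂ) + Complex.I * lam))
          (nhdsWithin 0 (Set.Ioi 0)) (nhds 1)) ∧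
      (∀ x ∈ Set.Ioo (0 : ℝ) A,
        Differentiable ℂ (S x) ∧ ∀ μ : ℂ, S x μ = S x (-μ)) := by
  have hq₀cont : ContinuousOn q₀ (Set.Ioo 0 A) := by
    have h : ContinuousOn (fun x : ℝ => q x - (-(lam : ℂ) ^ 2 - 1/4) / (x : ℂ) ^ 2)
        (Set.Ioo 0 A) :=
      hqcont.sub (continuousOn_const.div (by fun_prop) fun x hx =>
        pow_ne_zero 2 (Complex.ofReal_ne_zero.2 hx.1.ne'))
    exact h.congr fun x hx => by simp [hq x hx]
  obtain ⟨Y, hYd, hYlim, hYe⟩ := exists_amplitudes (lam := lam) hA hq₀cont hq₀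
  refine ⟨fun x μ => (Y x (μ ^ 2)).1 * (x : ℂ) ^ (1 / 2 - Complex.I * lam) +
    (Y x (μ ^ 2)).2 * (x : ℂ) ^ (1 / 2 + Complex.I * lam), fun μ x hx => ?_,
    fun μ => tendsto_of_amplitudes (hYlim (μ ^ 2)), fun x hx => ⟨?_, fun μ => by simp⟩⟩
  · have hmem := isOpen_Ioo.mem_nhds hx
    have hS := fun t (ht : t ∈ Set.Ioo 0 A) =>
      hasDerivAt_of_amplitudes hlam ht.1 (hYd (μ ^ 2) t ht)
    have hS1 := Filter.mem_of_superset hmem fun t ht => (hS t ht).1.deriv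
    have hS2 : ∀ t ∈ Set.Ioo 0 A, HasDerivAt _ _ t := fun t ht =>
      (hS t ht).2.congr_of_eventuallyEq
        (Filter.mem_of_superset (isOpen_Ioo.mem_nhds ht) fun s hs => (hS s hs).1.deriv)
    have hS3 := Filter.mem_of_superset hmem fun t ht => (hS2 t ht).deriv
    refine ⟨(hS x hx).1.differentiableAt, (hS2 x hx).differentiableAt, ?_, ?_⟩
    · refine ContinuousAt.congr_of_eventuallyEq ?_ hS3
      refine ContinuousAt.mul ?_ (hS x hx).1.continuousAt
      refine ((hqcont.continuousAt hmem).add_const (μ ^ 2)).congr ?_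
      filter_upwards [hmem] with t ht
      rw [hq t ht]
      ring
    · rw [(hS2 x hx).deriv, hq x hx]
      ring
  · have h : Differentiable ℂ fun μ => Y x (μ ^ 2) := (hYe x hx).comp (by fun_prop)
    exact (h.fst.mul_const _).add (h.snd.mul_const _)
end
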